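/- There exists n ∈ ℕ such that W_n = { ⟨m, ⌜φ⌝⟩ ∈ ℕ : φ is an 𝓛-formula with free variables ⊆ {x} and Σ(n) ⊨ φ(x|m̄) }. -/

import Mathlib

/-!
Formalization of the framework of "A machine that knows its own code" (S. Alexander).

The language 𝓛 is the language of Peano arithmetic (constant `0`, unary successor `S`,
binary `+` and `·`) extended by a unary modal operator `K`.
-/

/-- Terms of the language 𝓛 of Peano arithmetic (variables are indexed by `ℕ`). -/
inductive LTerm : Type
  | var : ℕ → LTerm
  | zero : LTerm
  | succ : LTerm → LTerm
  | add : LTerm → LTerm → LTerm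
  | mul : LTerm → LTerm → LTerm
  deriving DecidableEq

/-- Formulas of 𝓛: atomic equalities, falsum, implication, universal quantification,
and the modal operator `K`.  Other connectives and `∃` are defined below. -/
inductive LFormula : Type
  | eq : LTerm → LTerm → LFormula
  | falsum : LFormula
  | imp : LFormula → LFormula → LFormula
  | all : ℕ → LFormula → LFormula
  | K : LFormula → LFormula
  deriving DecidableEq

namespace LTerm

/-- Variables occurring in a term. -/
def fv : LTerm → Finset ℕ
  | var n => {n}
  | zero => ∅
  | succ t => t.fv
  | add t u => t.fv ∪ u.fv
  | mul t u => t.fv ∪ u.fv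

/-- Simultaneous substitution of terms for variables in a term. -/
def subst (s : ℕ → LTerm) : LTerm → LTerm
  | var n => s n
  | zero => zero
  | succ t => succ (t.subst s)
  | add t u => add (t.subst s) (u.subst s)
  | mul t u => mul (t.subst s) (u.subst s)

end LTerm

/-- The numeral `n̄` for a natural number `n`. -/
def numeral : ℕ → LTerm
  | 0 => LTerm.zero
  | n + 1 => LTerm.succ (numeral n)

namespace LFormula

/-- The free variables of a formula (the free variables of `K φ` are those of `φ`). -/
def fv : LFormula → Finset ℕ
  | eq t u => t.fv ∪ u.fv
  | falsum => ∅
  | imp a b => a.fv ∪ b.fv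
  | all x a => a.fv.erase x
  | K a => a.fv

/-- Simultaneous substitution of terms for the *free* variables of a formula
(bound variables are left untouched; the substitution is not capture-avoiding). -/
def subst (s : ℕ → LTerm) : LFormula → LFormula
  | eq t u => eq (t.subst s) (u.subst s)
  | falsum => falsum
  | imp a b => imp (a.subst s) (b.subst s)
  | all x a => all x (a.subst fun z => if z = x then LTerm.var x else s z)
  | K a => K (a.subst s)

end LFormula

/-- `subst1 x t φ` is `φ(x|t)`, the result of substituting the term `t` for the free
occurrences of the variable `x` in `φ`. -/
def subst1 (x : ℕ) (t : LTerm) (φ : LFormula) : LFormula :=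
  φ.subst fun z => if z = x then t else LTerm.var z

/-- `instNum s φ` is `φ^s`: the sentence obtained from `φ` by replacing each free
variable `x` of `φ` by the numeral for `s x`. -/
def instNum (s : ℕ → ℕ) (φ : LFormula) : LFormula :=
  φ.subst fun z => numeral (s z)

/-- `SubstitutableVar y x φ`: the variable `y` is substitutable for the variable `x`
in `φ` (no free occurrence of `x` lies within the scope of a quantifier binding `y`). -/
def SubstitutableVar (y x : ℕ) : LFormula → Prop
  | .eq _ _ => True
  | .falsum => True
  | .imp a b => SubstitutableVar y x a ∧ SubstitutableVar y x b
  | .all z a => x ∉ (LFormula.all z a).fv ∨ (y ≠ z ∧ SubstitutableVar y x a)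
  | .K a => SubstitutableVar y x a

/-- Correspondence of variables relative to a list of pairs of bound variables. -/
def VarCorr : List (ℕ × ℕ) → ℕ → ℕ → Prop
  | [], x, y => x = y
  | (a, b) :: Γ, x, y => (x = a ∧ y = b) ∨ (x ≠ a ∧ y ≠ b ∧ VarCorr Γ x y)

/-- Alpha-correspondence of terms relative to a list of pairs of bound variables. -/
def TermAlpha (Γ : List (ℕ × ℕ)) : LTerm → LTerm → Prop
  | .var x, .var y => VarCorr Γ x y
  | .zero, .zero => True
  | .succ t, .succ u => TermAlpha Γ t u
  | .add t₁ t₂, .add u₁ u₂ => TermAlpha Γ t₁ u₁ ∧ TermAlpha Γ t₂ u₂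
  | .mul t₁ t₂, .mul u₁ u₂ => TermAlpha Γ t₁ u₁ ∧ TermAlpha Γ t₂ u₂
  | _, _ => False

/-- Alpha-correspondence of formulas relative to a list of pairs of bound variables. -/
def FormulaAlpha : List (ℕ × ℕ) → LFormula → LFormula → Prop
  | Γ, .eq t₁ t₂, .eq u₁ u₂ => TermAlpha Γ t₁ u₁ ∧ TermAlpha Γ t₂ u₂
  | _, .falsum, .falsum => True
  | Γ, .imp a₁ a₂, .imp b₁ b₂ => FormulaAlpha Γ a₁ b₁ ∧ FormulaAlpha Γ a₂ b₂
  | Γ, .all x a, .all y b => FormulaAlpha ((x, y) :: Γ) a b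
  | Γ, .K a, .K b => FormulaAlpha Γ a b
  | _, _, _ => False

/-- `ψ` is an alphabetic variant of `φ`: `ψ` is obtained from `φ` by renaming bound
variables so as to respect the binding of the quantifiers. -/
def AlphaVariant (φ ψ : LFormula) : Prop := FormulaAlpha [] φ ψ

/-- Negation, defined from `→` and `⊥`. -/
def notF (φ : LFormula) : LFormula := LFormula.imp φ LFormula.falsum

/-- Conjunction (defined connective). -/
def andF (φ ψ : LFormula) : LFormula := notF (LFormula.imp φ (notF ψ))

/-- Biconditional (defined connective). -/
def iffF (φ ψ : LFormula) : LFormula := andF (LFormula.imp φ ψ) (LFormula.imp ψ φ)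

/-- Existential quantification (defined). -/
def exF (x : ℕ) (φ : LFormula) : LFormula := notF (LFormula.all x (notF φ))

/-- A canonical universal closure of a formula. -/
def uclose (φ : LFormula) : LFormula :=
  (φ.fv.sort (· ≤ ·)).foldr LFormula.all φ

/-- An 𝓛-structure: a first-order structure for the first-order part of 𝓛, together
with a truth assignment `satK s φ` for the purely modal formulas `K φ` at each
assignment `s` into the universe (the three required constraints are singled out
in `IsLStructure` below). -/
structure LStructure where
  U : Type
  nonempty : Nonempty U
  zero : U
  succ : U → U
  add : U → U → U
  mul : U → U → U
  satK : (ℕ → U) → LFormula → Prop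

namespace LStructure

/-- Value of a term under an assignment. -/
def evalT (M : LStructure) (s : ℕ → M.U) : LTerm → M.U
  | .var n => s n
  | .zero => M.zero
  | .succ t => M.succ (M.evalT s t)
  | .add t u => M.add (M.evalT s t) (M.evalT s u)
  | .mul t u => M.mul (M.evalT s t) (M.evalT s u)

/-- Satisfaction `M ⊨ φ[s]`, defined by the usual induction on formula complexity,
with `M ⊨ (K φ)[s]` given by the structure's truth assignment `satK`. -/
def Sat (M : LStructure) : (ℕ → M.U) → LFormula → Prop
  | s, .eq t u => M.evalT s t = M.evalT s u
  | _, .falsum => False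
  | s, .imp a b => M.Sat s a → M.Sat s b
  | s, .all x a => ∀ u : M.U, M.Sat (Function.update s x u) a
  | s, .K a => M.satK s a

/-- `M ⊨ φ`: `M ⊨ φ[s]` for every assignment `s`. -/
def Models (M : LStructure) (φ : LFormula) : Prop := ∀ s : ℕ → M.U, M.Sat s φ

end LStructure

/-- The three constraints making an `LStructure` a genuine 𝓛-structure of the base
logic: (a) `satK s φ` depends only on the values of `s` on the free variables of `φ`;
(b) invariance under alphabetic variants; (c) weak substitution. -/
def IsLStructure (M : LStructure) : Prop :=
  (∀ (φ : LFormula) (s t : ℕ → M.U), (∀ x ∈ φ.fv, s x = t x) →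
      (M.satK s φ ↔ M.satK t φ)) ∧
  (∀ (φ ψ : LFormula) (s : ℕ → M.U), AlphaVariant φ ψ →
      (M.satK s φ ↔ M.satK s ψ)) ∧
  (∀ (φ : LFormula) (x y : ℕ) (s : ℕ → M.U), SubstitutableVar y x φ →
      (M.satK s (subst1 x (LTerm.var y) φ) ↔ M.satK (Function.update s x (s y)) φ))

/-- `Σ ⊨ φ`: every 𝓛-structure satisfying every member of `Σ` satisfies `φ`. -/
def Consequence (T : Set LFormula) (φ : LFormula) : Prop :=
  ∀ M : LStructure, IsLStructure M → (∀ σ ∈ T, M.Models σ) → M.Models φ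

/-- `φ` is valid: `∅ ⊨ φ`, i.e. `φ` holds in every 𝓛-structure under every assignment. -/
def Valid (φ : LFormula) : Prop := Consequence ∅ φ

/-- The structure `M_Σ`: universe `ℕ`, standard interpretations of the symbols of
Peano arithmetic, and `M_Σ ⊨ (K φ)[s]` iff `Σ ⊨ φ^s`. -/
def MSigma (T : Set LFormula) : LStructure where
  U := ℕ
  nonempty := ⟨0⟩
  zero := 0
  succ := Nat.succ
  add := (· + ·)
  mul := (· * ·)
  satK := fun s φ => Consequence T (instNum s φ)

/-- Instances of the schema `E1`: the universal closure of `K φ` for valid `φ`. -/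
def E1set : Set LFormula :=
  {χ | ∃ φ : LFormula, Valid φ ∧ χ = uclose (LFormula.K φ)}

/-- Instances of the schema `E2`: the universal closure of `K(φ → ψ) → K φ → K ψ`. -/
def E2set : Set LFormula :=
  {χ | ∃ φ ψ : LFormula,
    χ = uclose (LFormula.imp (LFormula.K (LFormula.imp φ ψ))
      (LFormula.imp (LFormula.K φ) (LFormula.K ψ)))}

/-- Instances of the schema `E3` (factivity): the universal closure of `K φ → φ`. -/
def E3set : Set LFormula :=
  {χ | ∃ φ : LFormula, χ = uclose (LFormula.imp (LFormula.K φ) φ)}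

/-- Instances of the schema `E4`: the universal closure of `K φ → K K φ`. -/
def E4set : Set LFormula :=
  {χ | ∃ φ : LFormula, χ = uclose (LFormula.imp (LFormula.K φ) (LFormula.K (LFormula.K φ)))}

/-- The axioms of Peano arithmetic for 𝓛: the six usual axioms for successor,
addition and multiplication, and the induction schema extended to all 𝓛-formulas. -/
inductive PAax : LFormula → Prop
  | succ_ne_zero : PAax (.all 0 (notF (.eq (.succ (.var 0)) .zero)))
  | succ_inj : PAax (.all 0 (.all 1 (.imp (.eq (.succ (.var 0)) (.succ (.var 1)))
      (.eq (.var 0) (.var 1)))))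
  | add_zero : PAax (.all 0 (.eq (.add (.var 0) .zero) (.var 0)))
  | add_succ : PAax (.all 0 (.all 1 (.eq (.add (.var 0) (.succ (.var 1)))
      (.succ (.add (.var 0) (.var 1))))))
  | mul_zero : PAax (.all 0 (.eq (.mul (.var 0) .zero) .zero))
  | mul_succ : PAax (.all 0 (.all 1 (.eq (.mul (.var 0) (.succ (.var 1)))
      (.add (.mul (.var 0) (.var 1)) (.var 0)))))
  | ind (φ : LFormula) (x : ℕ) :
      PAax (uclose (.imp (subst1 x .zero φ)
        (.imp (.all x (.imp φ (subst1 x (.succ (.var x)) φ))) (.all x φ))))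

/-- The set of axioms of Peano arithmetic for 𝓛. -/
def PAset : Set LFormula := {φ | PAax φ}

/-- `W e`: the `e`-th recursively enumerable subset of `ℕ` (the domain of the `e`-th
partial computable function). -/
def W (e : ℕ) : Set ℕ :=
  {m | ((Denumerable.ofNat Nat.Partrec.Code e).eval m).Dom}

namespace LTerm

/-- A canonical Gödel numbering of terms. -/
def gnum : LTerm → ℕ
  | var n => Nat.pair 0 n
  | zero => Nat.pair 1 0
  | succ t => Nat.pair 2 t.gnum
  | add t u => Nat.pair 3 (Nat.pair t.gnum u.gnum)
  | mul t u => Nat.pair 4 (Nat.pair t.gnum u.gnum)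

end LTerm

namespace LFormula

/-- A canonical Gödel numbering `⌜φ⌝` of formulas. -/
def gnum : LFormula → ℕ
  | eq t u => Nat.pair 0 (Nat.pair t.gnum u.gnum)
  | falsum => Nat.pair 1 0
  | imp a b => Nat.pair 2 (Nat.pair a.gnum b.gnum)
  | all x a => Nat.pair 3 (Nat.pair x a.gnum)
  | K a => Nat.pair 4 a.gnum

end LFormula

/-- The designated variable `x`. -/
def vx : ℕ := 0
/-- The designated variable `y` (second pairing argument). -/
def vy : ℕ := 1
/-- The designated variable `e` (r.e. index). -/
def ve : ℕ := 2

/-- A formula is `K`-free (purely first-order) if the operator `K` does not occur in it. -/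
def KFree : LFormula → Prop
  | .eq _ _ => True
  | .falsum => True
  | .imp a b => KFree a ∧ KFree b
  | .all _ a => KFree a
  | .K _ => False

/-- The standard structure: universe `ℕ` with the standard interpretations of the
symbols of Peano arithmetic (the modal component is irrelevant for `K`-free formulas). -/
def StdModel : LStructure where
  U := ℕ
  nonempty := ⟨0⟩
  zero := 0
  succ := Nat.succ
  add := (· + ·)
  mul := (· * ·)
  satK := fun _ _ => False

/-- `pwNum pw a b k`: the result of substituting the numerals `ā`, `b̄`, `k̄` for the
designated variables `x`, `y`, `e` in the formula `pw` (read: `⟨ā, b̄⟩ ∈ W_k̄`). -/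
def pwNum (pw : LFormula) (a b k : ℕ) : LFormula :=
  instNum (fun z => if z = vx then a else if z = vy then b else k) pw

/-- `wNum w a k`: the result of substituting the numerals `ā`, `k̄` for the designated
variables `x`, `e` in the formula `w` (read: `ā ∈ W_k̄`). -/
def wNum (w : LFormula) (a k : ℕ) : LFormula :=
  instNum (fun z => if z = vx then a else k) w

/-- Line 3 of the definition of `Σ(n)`: the sentence
`∀x (K φ ↔ ⟨x, ⌜φ⌝⟩ ∈ W_n̄)`, where `pw` is the formula (with designated free
variables `x`, `y`, `e`) expressing `⟨x, y⟩ ∈ W_e`. -/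
def line3 (pw : LFormula) (n : ℕ) (φ : LFormula) : LFormula :=
  LFormula.all vx (iffF (LFormula.K φ)
    (subst1 ve (numeral n) (subst1 vy (numeral φ.gnum) pw)))

/-- Membership in the axiom set `Σ(n)` (relative to the formula `pw` expressing
`⟨x, y⟩ ∈ W_e`): (1) instances of `E1`, `E2`, `E4`; (2) the axioms of Peano
arithmetic for 𝓛; (3) `∀x (K φ ↔ ⟨x, ⌜φ⌝⟩ ∈ W_n̄)` for `φ` with free variables
⊆ {x}; (4) assigned validity `φ^s` for valid `φ`; (5) `K φ` for `φ` an instance of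
lines 1–4 or, recursively, of line 5. -/
inductive SigmaAx (pw : LFormula) (n : ℕ) : LFormula → Prop
  | e1 {χ : LFormula} (h : χ ∈ E1set) : SigmaAx pw n χ
  | e2 {χ : LFormula} (h : χ ∈ E2set) : SigmaAx pw n χ
  | e4 {χ : LFormula} (h : χ ∈ E4set) : SigmaAx pw n χ
  | pa {χ : LFormula} (h : PAax χ) : SigmaAx pw n χ
  | code (φ : LFormula) (h : φ.fv ⊆ {vx}) : SigmaAx pw n (line3 pw n φ)
  | av (φ : LFormula) (s : ℕ → ℕ) (h : Valid φ) : SigmaAx pw n (instNum s φ)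
  | k {φ : LFormula} (h : SigmaAx pw n φ) : SigmaAx pw n (LFormula.K φ)

/-- The axiom set `Σ(n)` (relative to `pw`). -/
def SigmaN (pw : LFormula) (n : ℕ) : Set LFormula := {φ | SigmaAx pw n φ}

/-- The set `{ ⟨m, ⌜φ⌝⟩ : φ an 𝓛-formula with free variables ⊆ {x} and
Σ(n) ⊨ φ(x|m̄) }`. -/
def goalSet (pw : LFormula) (n : ℕ) : Set ℕ :=
  {p | ∃ (m : ℕ) (φ : LFormula), p = Nat.pair m φ.gnum ∧ φ.fv ⊆ {vx} ∧
    Consequence (SigmaN pw n) (subst1 vx (numeral m) φ)}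

/-! ### Substitution and satisfaction -/

namespace LTerm

theorem subst_congr {s s' : ℕ → LTerm} :
    ∀ {t : LTerm}, (∀ x ∈ t.fv, s x = s' x) → t.subst s = t.subst s'
  | var _, h => h _ (by simp [fv])
  | zero, _ => rfl
  | succ t, h => congrArg succ (subst_congr (t := t) h)
  | add t u, h => congrArg₂ add (subst_congr fun x hx => h x (by simp [fv, hx]))
      (subst_congr fun x hx => h x (by simp [fv, hx]))
  | mul t u, h => congrArg₂ mul (subst_congr fun x hx => h x (by simp [fv, hx]))
      (subst_congr fun x hx => h x (by simp [fv, hx]))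

theorem subst_var (t : LTerm) : t.subst var = t := by
  induction t <;> simp_all [subst]

theorem subst_subst (s s' : ℕ → LTerm) (t : LTerm) :
    (t.subst s).subst s' = t.subst fun x => (s x).subst s' := by
  induction t <;> simp_all [subst]

theorem mem_fv_subst {s : ℕ → LTerm} {y : ℕ} {t : LTerm} :
    y ∈ (t.subst s).fv ↔ ∃ x ∈ t.fv, y ∈ (s x).fv := by
  induction t <;> simp_all [subst, fv, or_and_right, exists_or]

end LTerm

theorem numeral_subst (s : ℕ → LTerm) (m : ℕ) : (numeral m).subst s = numeral m := by
  induction m <;> simp_all [numeral, LTerm.subst]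

namespace LFormula

theorem subst_congr {φ : LFormula} {s s' : ℕ → LTerm} (h : ∀ x ∈ φ.fv, s x = s' x) :
    φ.subst s = φ.subst s' := by
  induction φ generalizing s s' with
  | eq t u =>
    simp only [fv, Finset.mem_union] at h
    simp only [subst]
    rw [LTerm.subst_congr fun x hx => h x (.inl hx), LTerm.subst_congr fun x hx => h x (.inr hx)]
  | falsum => rfl
  | imp a b iha ihb =>
    simp only [fv, Finset.mem_union] at h
    simp only [subst]
    rw [iha fun x hx => h x (.inl hx), ihb fun x hx => h x (.inr hx)]
  | all x a ih =>
    simp only [subst]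
    rw [ih]
    intro y hy
    by_cases hyx : y = x
    · simp [hyx]
    · simp [hyx, h y (by simp [fv, hyx, hy])]
  | K a ih => simp only [subst]; rw [ih h]

theorem subst_var (φ : LFormula) : φ.subst LTerm.var = φ := by
  induction φ with
  | all x a ih =>
    simp only [subst]
    rw [subst_congr (s' := LTerm.var), ih]
    intro y _
    by_cases h : y = x <;> simp [h]
  | _ => simp_all [subst, LTerm.subst_var]

/-- The quantifier nesting depth of a formula. -/
def ht : LFormula → ℕ
  | eq _ _ => 0
  | falsum => 0
  | imp a b => max a.ht b.ht
  | all _ a => a.ht + 1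
  | K a => a.ht

/-- The variables bound by some quantifier of a formula. -/
def bv : LFormula → Finset ℕ
  | eq _ _ => ∅
  | falsum => ∅
  | imp a b => a.bv ∪ b.bv
  | all x a => insert x a.bv
  | K a => a.bv

theorem ht_subst (s : ℕ → LTerm) (φ : LFormula) : (φ.subst s).ht = φ.ht := by
  induction φ generalizing s <;> simp_all [subst, ht]

end LFormula

theorem subst1_all (x : ℕ) (t : LTerm) (z : ℕ) (a : LFormula) :
    subst1 x t (.all z a) = if z = x then .all z a else .all z (subst1 x t a) := by
  unfold subst1
  split_ifs with h
  · rw [LFormula.subst_congr (s' := LTerm.var), LFormula.subst_var]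
    intro y hy
    rw [if_neg]
    rintro rfl
    simp [LFormula.fv, h] at hy
  · simp only [LFormula.subst]
    rw [LFormula.subst_congr]
    intro y _
    by_cases hy : y = z
    · subst hy; simp [h]
    · simp [hy]

theorem subst1_of_notMem {x : ℕ} {t : LTerm} {φ : LFormula} (h : x ∉ φ.fv) :
    subst1 x t φ = φ := by
  conv_rhs => rw [← φ.subst_var]
  refine LFormula.subst_congr fun y hy => ?_
  rw [if_neg]
  rintro rfl
  exact h hy

theorem ht_subst1 (x : ℕ) (t : LTerm) (φ : LFormula) : (subst1 x t φ).ht = φ.ht :=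
  LFormula.ht_subst _ _

theorem mem_fv_subst1_term {x y z : ℕ} {t : LTerm}
    (h : z ∈ (t.subst fun u => if u = x then .var y else .var u).fv) :
    (z = y ∧ x ∈ t.fv) ∨ (z ≠ x ∧ z ∈ t.fv) := by
  obtain ⟨u, hu, hz⟩ := LTerm.mem_fv_subst.1 h
  by_cases hux : u = x
  · simp [hux, LTerm.fv] at hz
    exact .inl ⟨hz, hux ▸ hu⟩
  · simp [hux, LTerm.fv] at hz
    exact .inr ⟨hz ▸ hux, hz ▸ hu⟩

theorem mem_fv_subst1 {x y z : ℕ} {φ : LFormula} (h : z ∈ (subst1 x (.var y) φ).fv) :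
    (z = y ∧ x ∈ φ.fv) ∨ (z ≠ x ∧ z ∈ φ.fv) := by
  induction φ with
  | eq t u =>
    simp only [subst1, LFormula.subst, LFormula.fv, Finset.mem_union] at h ⊢
    rcases h with h | h <;> rcases mem_fv_subst1_term h with h | h <;> tauto
  | falsum => simp [subst1, LFormula.subst, LFormula.fv] at h
  | imp a b iha ihb =>
    change z ∈ (subst1 x (.var y) a).fv ∪ (subst1 x (.var y) b).fv at h
    simp only [LFormula.fv, Finset.mem_union] at h ⊢
    tauto
  | all w a ih =>
    rw [subst1_all] at h
    split_ifs at h with hw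
    · subst hw
      refine .inr ⟨?_, h⟩
      rintro rfl
      simp [LFormula.fv] at h
    · simp only [LFormula.fv, Finset.mem_erase] at h ⊢
      have := ih h.2
      have : x ≠ w := fun e => hw e.symm
      tauto
  | K a ih => exact ih h

theorem substitutableVar_of_notMem_bv {y x : ℕ} {φ : LFormula} (h : y ∉ φ.bv) :
    SubstitutableVar y x φ := by
  induction φ <;> simp_all [SubstitutableVar, LFormula.bv]

namespace LStructure

variable (M : LStructure)

theorem evalT_congr {s s' : ℕ → M.U} :
    ∀ {t : LTerm}, (∀ x ∈ t.fv, s x = s' x) → M.evalT s t = M.evalT s' t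
  | .var _, h => h _ (by simp [LTerm.fv])
  | .zero, _ => rfl
  | .succ t, h => congrArg M.succ (evalT_congr (t := t) h)
  | .add t u, h => congrArg₂ M.add (evalT_congr fun x hx => h x (by simp [LTerm.fv, hx]))
      (evalT_congr fun x hx => h x (by simp [LTerm.fv, hx]))
  | .mul t u, h => congrArg₂ M.mul (evalT_congr fun x hx => h x (by simp [LTerm.fv, hx]))
      (evalT_congr fun x hx => h x (by simp [LTerm.fv, hx]))

theorem evalT_subst (s : ℕ → M.U) (f : ℕ → LTerm) (t : LTerm) :
    M.evalT s (t.subst f) = M.evalT (fun x => M.evalT s (f x)) t := by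
  induction t <;> simp_all [LTerm.subst, evalT]

variable {M}

theorem Sat_congr (hM : IsLStructure M) {φ : LFormula} {s s' : ℕ → M.U}
    (h : ∀ x ∈ φ.fv, s x = s' x) : M.Sat s φ ↔ M.Sat s' φ := by
  induction φ generalizing s s' with
  | eq t u =>
    simp only [LFormula.fv, Finset.mem_union] at h
    simp only [Sat]
    rw [M.evalT_congr fun x hx => h x (.inl hx), M.evalT_congr fun x hx => h x (.inr hx)]
  | falsum => rfl
  | imp a b iha ihb =>
    simp only [LFormula.fv, Finset.mem_union] at h
    simp only [Sat]
    rw [iha fun x hx => h x (.inl hx), ihb fun x hx => h x (.inr hx)]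
  | all x a ih =>
    refine forall_congr' fun u => ih fun y hy => ?_
    by_cases hyx : y = x
    · simp [hyx]
    · simp [hyx, h y (by simp [LFormula.fv, hyx, hy])]
  | K a ih => exact hM.1 a s s' h

theorem Sat_subst1 (hM : IsLStructure M) {x y : ℕ} {φ : LFormula} (h : SubstitutableVar y x φ)
    (s : ℕ → M.U) : M.Sat s (subst1 x (.var y) φ) ↔ M.Sat (Function.update s x (s y)) φ := by
  induction φ generalizing s with
  | eq t u =>
    simp only [subst1, LFormula.subst, Sat, evalT_subst]
    have : (fun z => M.evalT s (if z = x then .var y else .var z)) = Function.update s x (s y) := by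
      funext z
      by_cases hz : z = x
      · subst hz; simp [evalT]
      · simp [hz, evalT]
    rw [this]
  | falsum => rfl
  | imp a b iha ihb => exact imp_congr (iha h.1 s) (ihb h.2 s)
  | all z a ih =>
    by_cases hx : x ∈ (LFormula.all z a).fv
    · have hxz : x ≠ z := by rintro rfl; simp [LFormula.fv] at hx
      obtain ⟨hyz, h⟩ := h.resolve_left (not_not_intro hx)
      rw [subst1_all, if_neg hxz.symm]
      refine forall_congr' fun u => ?_
      rw [ih h, Function.update_of_ne hyz, Function.update_comm hxz.symm]
    · rw [subst1_of_notMem hx]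
      refine Sat_congr hM fun u hu => ?_
      rw [Function.update_of_ne]
      rintro rfl
      exact hx hu
  | K a ih => exact hM.2.2 a x y s h

end LStructure

/-! ### Canonical forms

`canon σ φ` renames the free variables of `φ` by `σ` and gives each bound variable an even name
that depends only on the quantifier depth of its scope. -/

namespace LFormula

/-- The canonical alphabetic form of `φ` with free variables renamed by `σ`. -/
def canon : (ℕ → ℕ) → LFormula → LFormula
  | σ, eq t u => eq (t.subst fun x => .var (σ x)) (u.subst fun x => .var (σ x))
  | _, falsum => falsum
  | σ, imp a b => imp (canon σ a) (canon σ b)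
  | σ, all x a => all (2 * a.ht) (canon (Function.update σ x (2 * a.ht)) a)
  | σ, K a => K (canon σ a)

theorem canon_congr {φ : LFormula} {σ τ : ℕ → ℕ} (h : ∀ x ∈ φ.fv, σ x = τ x) :
    canon σ φ = canon τ φ := by
  induction φ generalizing σ τ with
  | eq t u =>
    simp only [fv, Finset.mem_union] at h
    simp only [canon]
    rw [LTerm.subst_congr fun x hx => by rw [h x (.inl hx)],
      LTerm.subst_congr (t := u) fun x hx => by rw [h x (.inr hx)]]
  | falsum => rfl
  | imp a b iha ihb =>
    simp only [fv, Finset.mem_union] at h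
    simp only [canon]
    rw [iha fun x hx => h x (.inl hx), ihb fun x hx => h x (.inr hx)]
  | all x a ih =>
    simp only [canon]
    rw [ih]
    intro y hy
    by_cases hyx : y = x
    · simp [hyx]
    · simp [hyx, h y (by simp [fv, hyx, hy])]
  | K a ih => exact congrArg K (ih h)

theorem bv_canon {c : ℕ} {σ : ℕ → ℕ} {φ : LFormula} (h : c ∈ (canon σ φ).bv) :
    ∃ i < φ.ht, c = 2 * i := by
  induction φ generalizing σ with
  | eq t u => simp [canon, bv] at h
  | falsum => simp [canon, bv] at h
  | imp a b iha ihb =>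
    simp only [canon, bv, Finset.mem_union] at h
    rcases h with h | h
    · obtain ⟨i, hi, e⟩ := iha h
      exact ⟨i, lt_max_of_lt_left hi, e⟩
    · obtain ⟨i, hi, e⟩ := ihb h
      exact ⟨i, lt_max_of_lt_right hi, e⟩
  | all x a ih =>
    simp only [canon, bv, Finset.mem_insert] at h
    rcases h with h | h
    · exact ⟨a.ht, Nat.lt_succ_self _, h⟩
    · obtain ⟨i, hi, e⟩ := ih h
      exact ⟨i, Nat.lt_succ_of_lt hi, e⟩
  | K a ih => exact ih h

theorem subst1_canon {y z : ℕ} {σ : ℕ → ℕ} {φ : LFormula} (h : ∀ i < φ.ht, y ≠ 2 * i) :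
    subst1 y (.var z) (canon σ φ) = canon (fun u => if σ u = y then z else σ u) φ := by
  induction φ generalizing σ with
  | eq t u =>
    simp only [subst1, subst, canon, LTerm.subst_subst]
    congr 2 <;>
    · funext x
      simp only [LTerm.subst]
      split_ifs <;> rfl
  | falsum => rfl
  | imp a b iha ihb =>
    exact congrArg₂ imp (iha fun i hi => h i (lt_max_of_lt_left hi))
      (ihb fun i hi => h i (lt_max_of_lt_right hi))
  | all x a ih =>
    have hy : y ≠ 2 * a.ht := h _ (Nat.lt_succ_self _)
    rw [canon, subst1_all, if_neg hy.symm, ih fun i hi => h i (Nat.lt_succ_of_lt hi), canon]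
    congr 2
    funext u
    by_cases hu : u = x
    · subst hu; simp [hy.symm]
    · simp [hu]
  | K a ih => exact congrArg K (ih h)

theorem canon_subst1 {x y : ℕ} {σ : ℕ → ℕ} {φ : LFormula} (h : SubstitutableVar y x φ) :
    canon σ (subst1 x (.var y) φ) = canon (Function.update σ x (σ y)) φ := by
  induction φ generalizing σ with
  | eq t u =>
    simp only [subst1, subst, canon, LTerm.subst_subst]
    congr 2 <;>
    · funext z
      by_cases hz : z = x
      · subst hz; simp [LTerm.subst]
      · simp [hz, LTerm.subst]
  | falsum => rfl
  | imp a b iha ihb => exact congrArg₂ imp (iha h.1) (ihb h.2)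
  | all z a ih =>
    by_cases hx : x ∈ (all z a).fv
    · have hxz : x ≠ z := by rintro rfl; simp [fv] at hx
      obtain ⟨hyz, h⟩ := h.resolve_left (not_not_intro hx)
      rw [subst1_all, if_neg hxz.symm, canon, canon, ih h, ht_subst1,
        Function.update_of_ne hyz, Function.update_comm hxz.symm]
    · rw [subst1_of_notMem hx]
      refine canon_congr fun u hu => ?_
      rw [Function.update_of_ne]
      rintro rfl
      exact hx hu
  | K a ih => exact congrArg K (ih h)

end LFormula

theorem TermAlpha.subst_eq {Γ : List (ℕ × ℕ)} {σ τ : ℕ → ℕ} {t u : LTerm}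
    (h : TermAlpha Γ t u) (hΓ : ∀ x y, VarCorr Γ x y → σ x = τ y) :
    (t.subst fun x => .var (σ x)) = u.subst fun x => .var (τ x) := by
  induction t generalizing u with
  | var x =>
    cases u <;> simp only [TermAlpha] at h
    exact congrArg LTerm.var (hΓ _ _ h)
  | zero => cases u <;> simp_all [TermAlpha, LTerm.subst]
  | succ t ih =>
    cases u <;> simp only [TermAlpha] at h
    exact congrArg LTerm.succ (ih h)
  | add t t' ih ih' =>
    cases u <;> simp only [TermAlpha] at h
    exact congrArg₂ LTerm.add (ih h.1) (ih' h.2)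
  | mul t t' ih ih' =>
    cases u <;> simp only [TermAlpha] at h
    exact congrArg₂ LTerm.mul (ih h.1) (ih' h.2)

theorem FormulaAlpha.ht_eq {Γ : List (ℕ × ℕ)} {φ ψ : LFormula} (h : FormulaAlpha Γ φ ψ) :
    φ.ht = ψ.ht := by
  induction φ generalizing ψ Γ with
  | imp a b iha ihb =>
    cases ψ <;> simp only [FormulaAlpha] at h
    simp only [LFormula.ht, iha h.1, ihb h.2]
  | all x a ih =>
    cases ψ <;> simp only [FormulaAlpha] at h
    simp only [LFormula.ht, ih h]
  | K a ih =>
    cases ψ <;> simp only [FormulaAlpha] at h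
    simp only [LFormula.ht, ih h]
  | _ => cases ψ <;> simp_all [FormulaAlpha, LFormula.ht]

theorem FormulaAlpha.canon_eq {Γ : List (ℕ × ℕ)} {φ ψ : LFormula} {σ τ : ℕ → ℕ}
    (h : FormulaAlpha Γ φ ψ) (hΓ : ∀ x y, VarCorr Γ x y → σ x = τ y) :
    φ.canon σ = ψ.canon τ := by
  induction φ generalizing ψ Γ σ τ with
  | eq t u =>
    cases ψ <;> simp only [FormulaAlpha] at h
    simp only [LFormula.canon, h.1.subst_eq hΓ, h.2.subst_eq hΓ]
  | falsum => cases ψ <;> simp_all [FormulaAlpha, LFormula.canon]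
  | imp a b iha ihb =>
    cases ψ <;> simp only [FormulaAlpha] at h
    simp only [LFormula.canon, iha h.1 hΓ, ihb h.2 hΓ]
  | all x a ih =>
    cases ψ <;> simp only [FormulaAlpha] at h
    simp only [LFormula.canon, h.ht_eq]
    rw [ih h]
    rintro u v (⟨rfl, rfl⟩ | ⟨hu, hv, huv⟩)
    · simp
    · simp [hu, hv, hΓ u v huv]
  | K a ih =>
    cases ψ <;> simp only [FormulaAlpha] at h
    exact congrArg LFormula.K (ih h hΓ)

theorem termAlpha_subst {Γ : List (ℕ × ℕ)} {σ : ℕ → ℕ} {t : LTerm}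
    (h : ∀ x ∈ t.fv, VarCorr Γ x (σ x)) : TermAlpha Γ t (t.subst fun x => .var (σ x)) := by
  induction t <;> simp_all [TermAlpha, LTerm.subst, LTerm.fv]

theorem formulaAlpha_canon {Γ : List (ℕ × ℕ)} {σ : ℕ → ℕ} {φ : LFormula}
    (h : ∀ x ∈ φ.fv, VarCorr Γ x (σ x)) (hσ : ∀ x ∈ φ.fv, ∀ i < φ.ht, σ x ≠ 2 * i) :
    FormulaAlpha Γ φ (φ.canon σ) := by
  induction φ generalizing Γ σ with
  | eq t u =>
    simp only [LFormula.fv, Finset.mem_union] at h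
    exact ⟨termAlpha_subst fun x hx => h x (.inl hx), termAlpha_subst fun x hx => h x (.inr hx)⟩
  | falsum => trivial
  | imp a b iha ihb =>
    simp only [LFormula.fv, Finset.mem_union] at h hσ
    exact ⟨iha (fun x hx => h x (.inl hx)) fun x hx i hi => hσ x (.inl hx) i (lt_max_of_lt_left hi),
      ihb (fun x hx => h x (.inr hx)) fun x hx i hi => hσ x (.inr hx) i (lt_max_of_lt_right hi)⟩
  | all x a ih =>
    refine ih (fun y hy => ?_) fun y hy i hi => ?_
    · by_cases hyx : y = x
      · exact .inl ⟨hyx, by simp [hyx]⟩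
      · have hy' : y ∈ (LFormula.all x a).fv := by simp [LFormula.fv, hyx, hy]
        rw [Function.update_of_ne hyx]
        exact .inr ⟨hyx, hσ y hy' _ (Nat.lt_succ_self _), h y hy'⟩
    · by_cases hyx : y = x
      · subst hyx
        simp only [Function.update_self]
        omega
      · rw [Function.update_of_ne hyx]
        exact hσ y (by simp [LFormula.fv, hyx, hy]) i (Nat.lt_succ_of_lt hi)
  | K a ih => exact ih h hσ

namespace LStructure

variable {M : LStructure}

theorem satK_canon (hM : IsLStructure M) {φ : LFormula} {σ : ℕ → ℕ}
    (hσ : ∀ x ∈ φ.fv, ∀ i < φ.ht, σ x ≠ 2 * i) (s : ℕ → M.U) :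
    M.satK s (φ.canon σ) ↔ M.satK (fun x => s (σ x)) φ := by
  induction hk : (φ.fv.filter fun x => σ x ≠ x).card using Nat.strong_induction_on
    generalizing φ σ s with
  | _ k ih =>
    subst hk
    by_cases hid : ∀ x ∈ φ.fv, σ x = x
    · have hσ' : ∀ x ∈ φ.fv, ∀ i < φ.ht, id x ≠ 2 * i := fun x hx i hi => by
        have := hσ x hx i hi
        rwa [hid x hx] at this
      rw [LFormula.canon_congr (τ := id) hid]
      exact (hM.2.1 _ _ s (formulaAlpha_canon (Γ := []) (fun _ _ => rfl) hσ')).symm.trans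
        (hM.1 _ _ _ fun x hx => by rw [hid x hx])
    · push Not at hid
      obtain ⟨x, hx, hxσ⟩ := hid
      obtain ⟨N, hN⟩ := ((φ.fv ∪ φ.bv) ∪ (φ.fv.image σ)).exists_nat_subset_range
      have hlt : ∀ u, u ∈ φ.fv ∨ u ∈ φ.bv ∨ u ∈ φ.fv.image σ → u < N := fun u hu =>
        Finset.mem_range.1 (hN (by simp only [Finset.mem_union]; tauto))
      obtain ⟨z, hz, hNz⟩ : ∃ z, (∀ i, z ≠ 2 * i) ∧ N ≤ z :=
        ⟨2 * N + 1, fun i => by omega, by omega⟩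
      have hzfv : z ∉ φ.fv := fun h => by have := hlt z (.inl h); omega
      have hzσ : ∀ u ∈ φ.fv, σ u ≠ z := fun u hu e => by
        have := hlt (σ u) (.inr (.inr (Finset.mem_image_of_mem _ hu))); omega
      have hzx : SubstitutableVar z x φ := substitutableVar_of_notMem_bv fun h => by
        have := hlt z (.inr (.inl h)); omega
      set φ' := subst1 x (.var z) φ with hφ'
      set τ := Function.update σ z z with hτ
      have hfv : ∀ u ∈ φ'.fv, u = z ∨ (u ≠ x ∧ u ≠ z ∧ u ∈ φ.fv) := fun u hu => by
        rcases mem_fv_subst1 hu with h | h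
        · exact .inl h.1
        · exact .inr ⟨h.1, fun e => hzfv (e ▸ h.2), h.2⟩
      have hcard : (φ'.fv.filter fun u => τ u ≠ u).card <
          (φ.fv.filter fun u => σ u ≠ u).card := by
        refine Finset.card_lt_card ((Finset.ssubset_iff_of_subset fun u hu => ?_).2
          ⟨x, by simp [hx, hxσ], fun h => ?_⟩)
        · simp only [Finset.mem_filter] at hu ⊢
          rcases hfv u hu.1 with rfl | ⟨-, h1, h2⟩
          · simp [hτ] at hu
          · simpa [hτ, h1, h2] using hu.2
        · simp only [Finset.mem_filter] at h
          rcases hfv x h.1 with rfl | h'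
          · exact hzfv hx
          · exact h'.1 rfl
      have key := ih _ hcard (φ := φ') (σ := τ) (fun u hu i hi => by
        rcases hfv u hu with rfl | ⟨-, h1, h2⟩
        · simpa [hτ] using hz i
        · simpa [hτ, h1] using hσ u h2 i (by rwa [hφ', ht_subst1] at hi))
        (Function.update s z (s (σ x))) rfl
      have hsub : SubstitutableVar (σ x) z (φ'.canon τ) := substitutableVar_of_notMem_bv fun h => by
        obtain ⟨i, hi, e⟩ := LFormula.bv_canon h
        exact hσ x hx i (by rwa [hφ', ht_subst1] at hi) e
      have hcan : φ.canon σ = subst1 z (.var (σ x)) (φ'.canon τ) := by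
        rw [LFormula.subst1_canon fun i _ => hz i, hφ', LFormula.canon_subst1 hzx]
        refine LFormula.canon_congr fun u hu => ?_
        have huz : u ≠ z := fun e => hzfv (e ▸ hu)
        by_cases hux : u = x
        · simp [hux, hτ]
        · simp [hux, hτ, huz, hzσ u hu]
      rw [hcan, hM.2.2 _ _ _ _ hsub, key, hφ', hM.2.2 _ _ _ _ hzx]
      refine hM.1 _ _ _ fun u hu => ?_
      have huz : u ≠ z := fun e => hzfv (e ▸ hu)
      by_cases hux : u = x
      · simp [hux, hτ]
      · simp [hux, hτ, huz, hzσ u hu]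

theorem Sat_canon (hM : IsLStructure M) {φ : LFormula} {σ : ℕ → ℕ}
    (hσ : ∀ x ∈ φ.fv, ∀ i < φ.ht, σ x ≠ 2 * i) (s : ℕ → M.U) :
    M.Sat s (φ.canon σ) ↔ M.Sat (fun x => s (σ x)) φ := by
  induction φ generalizing σ s with
  | eq t u => simp only [LFormula.canon, Sat, evalT_subst, evalT]
  | falsum => rfl
  | imp a b iha ihb =>
    simp only [LFormula.fv, Finset.mem_union] at hσ
    exact imp_congr (iha (fun x hx i hi => hσ x (.inl hx) i (lt_max_of_lt_left hi)) s)
      (ihb (fun x hx i hi => hσ x (.inr hx) i (lt_max_of_lt_right hi)) s)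
  | all x a ih =>
    have hfv : ∀ y ∈ a.fv, y ≠ x → y ∈ (LFormula.all x a).fv := fun y hy hyx => by
      simp [LFormula.fv, hyx, hy]
    refine forall_congr' fun u => (ih (fun y hy i hi => ?_) _).trans
      (Sat_congr hM fun y hy => ?_)
    · by_cases hyx : y = x
      · subst hyx
        simp only [Function.update_self]
        omega
      · rw [Function.update_of_ne hyx]
        exact hσ y (hfv y hy hyx) i (Nat.lt_succ_of_lt hi)
    · by_cases hyx : y = x
      · simp [hyx]
      · simp [hyx, hσ y (hfv y hy hyx) _ (Nat.lt_succ_self _)]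
  | K a => exact satK_canon (φ := a) hM hσ s

end LStructure

/-! ### Gödel numbers and universal closures -/

theorem LTerm.gnum_injective : Function.Injective LTerm.gnum := by
  intro t
  induction t with
  | var n => intro u; cases u <;> simp [gnum, Nat.pair_eq_pair]
  | zero => intro u; cases u <;> simp [gnum, Nat.pair_eq_pair]
  | succ t ih => intro u; cases u <;> simp [gnum, Nat.pair_eq_pair]; exact fun h => ih h
  | add t t' ih ih' =>
    intro u; cases u <;> simp [gnum, Nat.pair_eq_pair]; exact fun h h' => ⟨ih h, ih' h'⟩
  | mul t t' ih ih' =>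
    intro u; cases u <;> simp [gnum, Nat.pair_eq_pair]; exact fun h h' => ⟨ih h, ih' h'⟩

theorem LFormula.gnum_injective : Function.Injective LFormula.gnum := by
  intro φ
  induction φ with
  | eq t u =>
    intro ψ; cases ψ <;> simp [gnum, Nat.pair_eq_pair]
    exact fun h h' => ⟨LTerm.gnum_injective h, LTerm.gnum_injective h'⟩
  | falsum => intro ψ; cases ψ <;> simp [gnum, Nat.pair_eq_pair]
  | imp a b iha ihb =>
    intro ψ; cases ψ <;> simp [gnum, Nat.pair_eq_pair]; exact fun h h' => ⟨iha h, ihb h'⟩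
  | all x a ih =>
    intro ψ; cases ψ <;> simp [gnum, Nat.pair_eq_pair]; exact fun h h' => ⟨h, ih h'⟩
  | K a ih => intro ψ; cases ψ <;> simp [gnum, Nat.pair_eq_pair]; exact fun h => ih h

theorem LTerm.le_gnum {x : ℕ} {t : LTerm} (h : x ∈ t.fv) : x ≤ t.gnum := by
  have l := Nat.left_le_pair
  have r := Nat.right_le_pair
  induction t with
  | var n => simp [fv] at h; subst h; exact r _ _
  | zero => simp [fv] at h
  | succ t ih => exact (ih h).trans (r _ _)
  | add t u iht ihu =>
    simp only [fv, Finset.mem_union] at h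
    rcases h with h | h
    · exact (iht h).trans ((l _ _).trans (r _ _))
    · exact (ihu h).trans ((r _ _).trans (r _ _))
  | mul t u iht ihu =>
    simp only [fv, Finset.mem_union] at h
    rcases h with h | h
    · exact (iht h).trans ((l _ _).trans (r _ _))
    · exact (ihu h).trans ((r _ _).trans (r _ _))

theorem LFormula.le_gnum {x : ℕ} {φ : LFormula} (h : x ∈ φ.fv ∨ x ∈ φ.bv) : x ≤ φ.gnum := by
  have l := Nat.left_le_pair
  have r := Nat.right_le_pair
  induction φ with
  | eq t u =>
    simp only [fv, bv, Finset.mem_union, Finset.notMem_empty, or_false] at h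
    rcases h with h | h
    · exact (LTerm.le_gnum h).trans ((l _ _).trans (r _ _))
    · exact (LTerm.le_gnum h).trans ((r _ _).trans (r _ _))
  | falsum => simp [fv, bv] at h
  | imp a b iha ihb =>
    simp only [fv, bv, Finset.mem_union] at h
    rcases (by tauto : (x ∈ a.fv ∨ x ∈ a.bv) ∨ (x ∈ b.fv ∨ x ∈ b.bv)) with h | h
    · exact (iha h).trans ((l _ _).trans (r _ _))
    · exact (ihb h).trans ((r _ _).trans (r _ _))
  | all y a ih =>
    simp only [fv, bv, Finset.mem_erase, Finset.mem_insert] at h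
    rcases (by tauto : x = y ∨ (x ∈ a.fv ∨ x ∈ a.bv)) with rfl | h
    · exact (l _ _).trans (r _ _)
    · exact (ih h).trans ((r _ _).trans (r _ _))
  | K a ih => exact (ih h).trans (r _ _)

theorem fv_foldr_all (l : List ℕ) (φ : LFormula) :
    (l.foldr LFormula.all φ).fv = φ.fv \ l.toFinset := by
  induction l with
  | nil => simp
  | cons x l ih =>
    ext y
    simp only [List.foldr_cons, LFormula.fv, ih, Finset.mem_erase, Finset.mem_sdiff,
      List.toFinset_cons, Finset.mem_insert]
    tauto

theorem fv_uclose (φ : LFormula) : (uclose φ).fv = ∅ := by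
  simp [uclose, fv_foldr_all]

namespace LStructure

theorem models_all {M : LStructure} {x : ℕ} {φ : LFormula} :
    M.Models (.all x φ) ↔ M.Models φ :=
  ⟨fun h s => by simpa using h s (s x), fun h s u => h _⟩

theorem models_uclose {M : LStructure} {φ : LFormula} : M.Models (uclose φ) ↔ M.Models φ := by
  unfold uclose
  induction φ.fv.sort (· ≤ ·) with
  | nil => rfl
  | cons x l ih => rw [List.foldr_cons, models_all, ih]

end LStructure

/-! ### A Hilbert calculus -/

/-- The variable witnessing the Henkin axiom for `∀ z, B`. -/
def henkinVar (z : ℕ) (B : LFormula) : ℕ := 2 * (LFormula.all z B).gnum + 1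

/-- The renaming that makes every variable odd. -/
def oddVar (x : ℕ) : ℕ := 2 * x + 1

/-- The term `t` with each variable renamed by `σ`. -/
def LTerm.rename (σ : ℕ → ℕ) (t : LTerm) : LTerm := t.subst fun x => .var (σ x)

/-- The logical axioms of the calculus. -/
inductive LogAx : LFormula → Prop
  | weak (a b : LFormula) : LogAx (.imp a (.imp b a))
  | dist (a b c : LFormula) :
      LogAx (.imp (.imp a (.imp b c)) (.imp (.imp a b) (.imp a c)))
  | dne (a : LFormula) : LogAx (.imp (notF (notF a)) a)
  | inst (z c : ℕ) (B : LFormula) (h : c ∉ B.bv) : LogAx (.imp (.all z B) (subst1 z (.var c) B))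
  | henkin (z : ℕ) (B : LFormula) :
      LogAx (.imp (subst1 z (.var (henkinVar z B)) B) (.all z B))
  | leibniz (z c d : ℕ) (B : LFormula) (hc : c ∉ B.bv) (hd : d ∉ B.bv) :
      LogAx (.imp (.eq (.var c) (.var d))
        (.imp (subst1 z (.var c) B) (subst1 z (.var d) B)))
  | exists_eq (t : LTerm) :
      LogAx (notF (.all 0 (notF (.eq (.var 0) (t.rename oddVar)))))
  | refl (t : LTerm) : LogAx (.eq t t)
  | euclid (t u w : LTerm) : LogAx (.imp (.eq t u) (.imp (.eq t w) (.eq u w)))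
  | succ (t t' : LTerm) : LogAx (.imp (.eq t t') (.eq (.succ t) (.succ t')))
  | add (t t' u u' : LTerm) :
      LogAx (.imp (.eq t t') (.imp (.eq u u') (.eq (.add t u) (.add t' u'))))
  | mul (t t' u w : LTerm) :
      LogAx (.imp (.eq t t') (.imp (.eq u w) (.eq (.mul t u) (.mul t' w))))

/-- Derivability from a set of formulas by modus ponens. -/
inductive Prov (Γ : Set LFormula) : LFormula → Prop
  | ax {φ : LFormula} : φ ∈ Γ → Prov Γ φ
  | mp {φ ψ : LFormula} : Prov Γ (.imp φ ψ) → Prov Γ φ → Prov Γ ψ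

/-- The canonical closed form of a formula. -/
def closedForm (φ : LFormula) : LFormula := (uclose φ).canon oddVar

/-- The axioms of the calculus with hypotheses `T`. -/
def HypAx (T : Set LFormula) : Set LFormula :=
  {χ | LogAx χ} ∪ {χ | ∃ σ ∈ T, χ = closedForm σ}

/-! ### Soundness -/

namespace LStructure

variable {M : LStructure}

theorem sat_closedForm (hM : IsLStructure M) {φ : LFormula} (s : ℕ → M.U) :
    M.Sat s (closedForm φ) ↔ M.Models φ := by
  rw [closedForm, Sat_canon hM (by simp [fv_uclose]), ← models_uclose]
  exact ⟨fun h s' => (Sat_congr hM (by simp [fv_uclose])).1 h, fun h => h _⟩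

theorem exists_henkin_valuation (hM : IsLStructure M) :
    ∃ val : ℕ → M.U, ∀ z B, M.Sat (Function.update val z (val (henkinVar z B))) B →
      M.Sat val (.all z B) := by
  classical
  have := M.nonempty
  let good (n : ℕ) (s : ℕ → M.U) (u : M.U) : Prop := ∀ z B, n = henkinVar z B →
    M.Sat (Function.update s z u) B → M.Sat s (.all z B)
  have hgood : ∀ n s, ∃ u, good n s u := by
    intro n s
    by_cases h : ∃ z B, n = henkinVar z B ∧ ∃ u, ¬ M.Sat (Function.update s z u) B
    · obtain ⟨z, B, hn, u, hu⟩ := h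
      refine ⟨u, fun z' B' hn' hs => ?_⟩
      have : LFormula.all z B = .all z' B' := LFormula.gnum_injective (by
        have := hn.symm.trans hn'
        unfold henkinVar at this
        omega)
      cases this
      exact absurd hs hu
    · push Not at h
      exact ⟨Classical.arbitrary _, fun z B hn _ u => h z B hn u⟩
  choose pick hpick using hgood
  let step (n : ℕ) (f : (m : ℕ) → m < n → M.U) : M.U :=
    pick n fun m => if h : m < n then f m h else Classical.arbitrary _
  let val : ℕ → M.U := fun n => Nat.strongRecOn n step
  have hval : ∀ n, val n = pick n fun m => if m < n then val m else Classical.arbitrary _ := by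
    intro n
    exact Nat.strongRecOn_eq (motive := fun _ => M.U) step n
  refine ⟨val, fun z B hs => ?_⟩
  set n := henkinVar z B with hn
  have hlt : ∀ x, x ∈ (LFormula.all z B).fv ∨ x ∈ (LFormula.all z B).bv → x < n := fun x hx => by
    have := LFormula.le_gnum hx
    simp only [hn, henkinVar]
    omega
  set s : ℕ → M.U := fun m => if m < n then val m else Classical.arbitrary _ with hsdef
  have hsv : ∀ x, x < n → s x = val x := fun x hx => by simp [hsdef, hx]
  have h1 : M.Sat (Function.update s z (val n)) B := by
    refine (Sat_congr hM fun x hx => ?_).1 hs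
    by_cases hxz : x = z
    · simp [hxz]
    · simp only [Function.update_of_ne hxz]
      exact (hsv x (hlt x (.inl (by simp [LFormula.fv, hx, hxz])))).symm
  rw [hval n] at h1
  exact (Sat_congr hM fun x hx => hsv x (hlt x (.inl hx))).1 (hpick n s z B hn h1)

theorem sat_logAx (hM : IsLStructure M) {val : ℕ → M.U}
    (hval : ∀ z B, M.Sat (Function.update val z (val (henkinVar z B))) B →
      M.Sat val (.all z B)) {φ : LFormula} (h : LogAx φ) : M.Sat val φ := by
  have hsub : ∀ {z c : ℕ} {B : LFormula}, c ∉ B.bv →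
      (M.Sat val (subst1 z (.var c) B) ↔ M.Sat (Function.update val z (val c)) B) :=
    fun hc => Sat_subst1 hM (substitutableVar_of_notMem_bv hc) val
  cases h with
  | weak a b => exact fun h _ => h
  | dist a b c => exact fun h h' h'' => h h'' (h' h'')
  | dne a => exact fun h => not_not.1 h
  | inst z c B hc => exact fun h => (hsub hc).2 (h _)
  | henkin z B =>
    intro h
    refine hval z B ((hsub fun hc => ?_).1 h)
    have := LFormula.le_gnum (φ := .all z B) (.inr (Finset.mem_insert_of_mem hc))
    simp only [henkinVar] at this
    omega
  | leibniz z c d B hc hd =>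
    intro h h'
    rw [hsub hc] at h'
    rw [hsub hd]
    have h : val c = val d := h
    rwa [← h]
  | exists_eq t =>
    intro h
    refine h (M.evalT val (t.rename oddVar)) ?_
    change M.evalT _ _ = M.evalT _ _
    simp only [LTerm.rename, evalT_subst, evalT]
    simp [oddVar]
  | refl t => rfl
  | euclid t u w => exact fun h h' => h.symm.trans h'
  | succ t t' => exact fun h => congrArg M.succ h
  | add t t' u u' => exact fun h h' => congrArg₂ M.add h h'
  | mul t t' u u' => exact fun h h' => congrArg₂ M.mul h h'

end LStructure

theorem consequence_of_prov {T : Set LFormula} {φ : LFormula}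
    (h : Prov (HypAx T) (closedForm φ)) : Consequence T φ := by
  intro M hM hT
  obtain ⟨val, hval⟩ := LStructure.exists_henkin_valuation hM
  rw [← LStructure.sat_closedForm hM val]
  generalize closedForm φ = χ at h
  induction h with
  | ax h =>
    rcases h with h | ⟨σ, hσ, rfl⟩
    · exact LStructure.sat_logAx hM hval h
    · exact (LStructure.sat_closedForm hM val).2 (hT σ hσ)
  | mp _ _ ih₁ ih₂ => exact ih₁ ih₂

/-! ### Completeness -/

namespace Prov

variable {Γ Δ : Set LFormula} {φ ψ : LFormula}

theorem mono (hΓ : Γ ⊆ Δ) (h : Prov Γ φ) : Prov Δ φ := by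
  induction h with
  | ax h => exact ax (hΓ h)
  | mp _ _ ih ih' => exact mp ih ih'

theorem deduction (hΓ : {χ | LogAx χ} ⊆ Γ) (h : Prov (insert φ Γ) ψ) : Prov Γ (.imp φ ψ) := by
  induction h with
  | @ax ψ h =>
    rcases h with rfl | h
    · exact mp (mp (ax (hΓ (.dist ψ (.imp ψ ψ) ψ))) (ax (hΓ (.weak _ _)))) (ax (hΓ (.weak _ _)))
    · exact mp (ax (hΓ (.weak _ _))) (ax h)
  | mp _ _ ih ih' => exact mp (mp (ax (hΓ (.dist _ _ _))) ih) ih'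

theorem of_falsum (hΓ : {χ | LogAx χ} ⊆ Γ) (h : Prov Γ .falsum) : Prov Γ φ :=
  mp (ax (hΓ (.dne φ))) (mp (ax (hΓ (.weak _ _))) h)

theorem exists_of_chain {c : Set (Set LFormula)} (hc : IsChain (· ⊆ ·) c)
    (h : Prov (⋃₀ c) φ) : ∃ Δ ∈ c, Prov Δ φ := by
  induction h with
  | ax h =>
    obtain ⟨Δ, hΔ, h⟩ := h
    exact ⟨Δ, hΔ, ax h⟩
  | mp _ _ ih ih' =>
    obtain ⟨Δ, hΔ, h⟩ := ih
    obtain ⟨Δ', hΔ', h'⟩ := ih'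
    rcases hc.total hΔ hΔ' with hs | hs
    · exact ⟨Δ', hΔ', mp (h.mono hs) h'⟩
    · exact ⟨Δ, hΔ, mp h (h'.mono hs)⟩

end Prov

/-- If `φ` is not derivable from `Γ`, some Boolean valuation of formulas satisfies `Γ`
and refutes `φ`. -/
theorem exists_valuation {Γ : Set LFormula} {φ : LFormula} (hΓ : {χ | LogAx χ} ⊆ Γ)
    (h : ¬ Prov Γ φ) : ∃ v : LFormula → Prop, ¬ v .falsum ∧
      (∀ a b, v (.imp a b) ↔ (v a → v b)) ∧ (∀ χ ∈ Γ, v χ) ∧ ¬ v φ := by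
  have h0 : ¬ Prov (insert (notF φ) Γ) .falsum := fun h' =>
    h (.mp (.ax (hΓ (.dne φ))) (Prov.deduction hΓ h'))
  obtain ⟨Δ, hΔ, hmax⟩ := zorn_subset_nonempty {Δ | ¬ Prov Δ .falsum} (fun c hc hchain _ =>
    ⟨⋃₀ c, fun h' => by
      obtain ⟨Δ, hΔ, h''⟩ := Prov.exists_of_chain hchain h'
      exact hc hΔ h'', fun s hs => Set.subset_sUnion_of_mem hs⟩) _ h0
  have hΓΔ : Γ ⊆ Δ := (Set.subset_insert _ _).trans hΔ
  have hlog := hΓ.trans hΓΔ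
  have hcons : ¬ Prov Δ .falsum := hmax.prop
  have hmem : ∀ ψ, ¬ Prov (insert ψ Δ) .falsum → ψ ∈ Δ := fun ψ hψ =>
    hmax.le_of_ge hψ (Set.subset_insert _ _) (Set.mem_insert _ _)
  have hclosed : ∀ ψ, Prov Δ ψ → ψ ∈ Δ := fun ψ hψ => hmem ψ fun h' =>
    hcons (.mp (Prov.deduction hlog h') hψ)
  refine ⟨(· ∈ Δ), fun h' => hcons (.ax h'), fun a b => ⟨fun h' ha => ?_, fun h' => ?_⟩,
    fun χ hχ => hΓΔ hχ, fun hf => ?_⟩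
  · exact hclosed _ (.mp (.ax h') (.ax ha))
  · refine hclosed _ (Prov.deduction hlog ?_)
    by_cases ha : a ∈ Δ
    · exact (Prov.ax (h' ha)).mono (Set.subset_insert _ _)
    · exact Prov.of_falsum (hlog.trans (Set.subset_insert _ _)) (not_not.1 fun hf => ha (hmem a hf))
  · exact hcons (.mp (.ax (hΔ (Set.mem_insert _ _))) (.ax hf))

/-- A Boolean valuation satisfying the logical axioms. -/
structure LogValuation where
  v : LFormula → Prop
  v_falsum : ¬ v .falsum
  v_imp : ∀ a b, v (.imp a b) ↔ (v a → v b)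
  v_log : ∀ χ, LogAx χ → v χ

namespace LogValuation

variable (V : LogValuation)

theorem eq_refl (t : LTerm) : V.v (.eq t t) := V.v_log _ (.refl t)

variable {V}

theorem eq_euclid {t u w : LTerm} (h : V.v (.eq t u)) (h' : V.v (.eq t w)) : V.v (.eq u w) :=
  (V.v_imp _ _).1 ((V.v_imp _ _).1 (V.v_log _ (.euclid t u w)) h) h'

theorem eq_symm {t u : LTerm} (h : V.v (.eq t u)) : V.v (.eq u t) := eq_euclid h (V.eq_refl t)

theorem eq_trans {t u w : LTerm} (h : V.v (.eq t u)) (h' : V.v (.eq u w)) : V.v (.eq t w) :=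
  eq_euclid (eq_symm h) h'

theorem eq_succ {t t' : LTerm} (h : V.v (.eq t t')) : V.v (.eq t.succ t'.succ) :=
  (V.v_imp _ _).1 (V.v_log _ (.succ _ _)) h

theorem eq_add {t t' u u' : LTerm} (h : V.v (.eq t t')) (h' : V.v (.eq u u')) :
    V.v (.eq (t.add u) (t'.add u')) :=
  (V.v_imp _ _).1 ((V.v_imp _ _).1 (V.v_log _ (.add _ _ _ _)) h) h'

theorem eq_mul {t t' u u' : LTerm} (h : V.v (.eq t t')) (h' : V.v (.eq u u')) :
    V.v (.eq (t.mul u) (t'.mul u')) :=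
  (V.v_imp _ _).1 ((V.v_imp _ _).1 (V.v_log _ (.mul _ _ _ _)) h) h'

variable (V)

theorem exists_witness (t : LTerm) : ∃ c, V.v (.eq (.var (oddVar c)) (t.rename oddVar)) := by
  set B := notF (.eq (.var 0) (t.rename oddVar)) with hB
  refine ⟨(LFormula.all 0 B).gnum, not_not.1 fun h => ?_⟩
  have hsub : ∀ w, subst1 0 (.var w) B = notF (.eq (.var w) (t.rename oddVar)) := by
    intro w
    simp only [hB, subst1, notF, LFormula.subst, LTerm.rename, LTerm.subst_subst, LTerm.subst,
      if_true]
    simp [oddVar]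
  have h1 := (V.v_imp _ _).1 (V.v_log _ (.henkin 0 B))
  rw [hsub, notF, V.v_imp] at h1
  exact V.v_falsum ((V.v_imp _ _).1 (V.v_log _ (.exists_eq t)) (h1 fun hn => absurd hn h))

/-- A name for a term: a parameter equal to it. -/
noncomputable def wit (t : LTerm) : ℕ := (V.exists_witness t).choose

theorem eq_wit (t : LTerm) : V.v (.eq (.var (oddVar (V.wit t))) (t.rename oddVar)) :=
  (V.exists_witness t).choose_spec

/-- Parameters up to provable equality. -/
def setoid : Setoid ℕ where
  r c d := V.v (.eq (.var (oddVar c)) (.var (oddVar d)))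
  iseqv := ⟨fun _ => V.eq_refl _, eq_symm, eq_trans⟩

/-- The renaming of variables determined by an assignment. -/
noncomputable def ren (s : ℕ → Quotient V.setoid) (x : ℕ) : ℕ := oddVar (s x).out

/-- The term structure of a valuation. -/
noncomputable def model : LStructure where
  U := Quotient V.setoid
  nonempty := ⟨Quotient.mk _ 0⟩
  zero := Quotient.mk _ (V.wit .zero)
  succ u := Quotient.mk _ (V.wit (.succ (.var u.out)))
  add u u' := Quotient.mk _ (V.wit (.add (.var u.out) (.var u'.out)))
  mul u u' := Quotient.mk _ (V.wit (.mul (.var u.out) (.var u'.out)))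
  satK s φ := V.v (.K (φ.canon (V.ren s)))

theorem model_isLStructure : IsLStructure V.model := by
  refine ⟨fun φ s t h => ?_, fun φ ψ s h => ?_, fun φ x y s h => ?_⟩
  · change V.v _ ↔ V.v _
    rw [LFormula.canon_congr (σ := V.ren s) (τ := V.ren t) fun x hx => 
      congrArg (fun u : Quotient V.setoid => oddVar u.out) (h x hx)]
  · change V.v _ ↔ V.v _
    rw [FormulaAlpha.canon_eq (τ := V.ren s) h fun x y (e : x = y) => congrArg _ e]
  · change V.v _ ↔ V.v _
    rw [LFormula.canon_subst1 h, LFormula.canon_congr fun u _ => ?_]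
    by_cases hu : u = x
    · subst hu; simp [ren]
    · simp [hu, ren]

theorem eq_out (c : ℕ) :
    V.v (.eq (.var (oddVar (Quotient.mk V.setoid c).out)) (.var (oddVar c))) :=
  Quotient.mk_out (s := V.setoid) c

theorem eq_evalT (s : ℕ → V.model.U) (t : LTerm) :
    V.v (.eq (.var (oddVar (Quotient.out (V.model.evalT s t)))) (t.rename (V.ren s))) := by
  induction t with
  | var n => exact V.eq_refl _
  | zero => exact eq_trans (V.eq_out _) (V.eq_wit _)
  | succ t ih => exact eq_trans (eq_trans (V.eq_out _) (V.eq_wit _)) (eq_succ ih)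
  | add t u ih ih' => exact eq_trans (eq_trans (V.eq_out _) (V.eq_wit _)) (eq_add ih ih')
  | mul t u ih ih' => exact eq_trans (eq_trans (V.eq_out _) (V.eq_wit _)) (eq_mul ih ih')

theorem oddVar_notMem_bv_canon (c : ℕ) (σ : ℕ → ℕ) (φ : LFormula) :
    oddVar c ∉ (φ.canon σ).bv := fun h => by
  obtain ⟨i, _, e⟩ := LFormula.bv_canon h
  simp only [oddVar] at e
  omega

theorem sat_model (s : ℕ → V.model.U) (φ : LFormula) :
    V.model.Sat s φ ↔ V.v (φ.canon (V.ren s)) := by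
  induction φ generalizing s with
  | eq t u =>
    have ht := V.eq_evalT s t
    have hu := V.eq_evalT s u
    change V.model.evalT s t = V.model.evalT s u ↔
      V.v (.eq (t.rename (V.ren s)) (u.rename (V.ren s)))
    refine ⟨fun h => ?_, fun h => ?_⟩
    · rw [h] at ht
      exact eq_euclid ht hu
    · rw [← Quotient.out_eq (V.model.evalT s t), ← Quotient.out_eq (V.model.evalT s u)]
      exact Quotient.sound (eq_trans (eq_trans ht h) (eq_symm hu))
  | falsum => exact iff_of_false id V.v_falsum
  | imp a b iha ihb => exact (imp_congr (iha s) (ihb s)).trans (V.v_imp _ _).symm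
  | all x a ih =>
    set z := 2 * a.ht with hz
    set B := a.canon (Function.update (V.ren s) x z) with hB
    have hsub : ∀ c, subst1 z (.var c) B = a.canon (Function.update (V.ren s) x c) := by
      intro c
      rw [hB, LFormula.subst1_canon fun i hi => by omega]
      refine LFormula.canon_congr fun u _ => ?_
      by_cases hu : u = x
      · simp [hu]
      · have : V.ren s u ≠ z := by simp only [ren, oddVar]; omega
        simp [hu, this]
    have hbv : ∀ c, oddVar c ∉ B.bv := fun c => oddVar_notMem_bv_canon c _ _
    have hren : ∀ u : V.model.U, V.ren (Function.update s x u : ℕ → V.model.U) =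
        Function.update (V.ren s) x (oddVar (Quotient.out u)) := by
      intro u
      funext y
      by_cases hy : y = x
      · subst hy
        rw [Function.update_self]
        exact congrArg (fun u => oddVar (Quotient.out u)) (Function.update_self y u s)
      · rw [Function.update_of_ne hy]
        exact congrArg (fun u => oddVar (Quotient.out u)) (Function.update_of_ne hy u s)
    change (∀ u, V.model.Sat (Function.update s x u) a) ↔ V.v (.all z B)
    refine ⟨fun h => ?_, fun h u => ?_⟩
    · refine (V.v_imp _ _).1 (V.v_log _ (.henkin z B)) ?_
      set g := (LFormula.all z B).gnum with hg
      let q : V.model.U := Quotient.mk V.setoid g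
      have h1 := (ih _).1 (h q)
      rw [hren, ← hsub] at h1
      exact (V.v_imp _ _).1 ((V.v_imp _ _).1 (V.v_log _ (.leibniz z _ _ B (hbv _) (hbv g)))
        (V.eq_out g)) h1
    · rw [ih, hren, ← hsub]
      exact (V.v_imp _ _).1 (V.v_log _ (.inst z _ B (hbv _))) h
  | K a => rfl

theorem models_model (φ : LFormula) : V.model.Models φ ↔ V.v (closedForm φ) := by
  obtain ⟨u⟩ := V.model.nonempty
  have h : closedForm φ = (uclose φ).canon (V.ren fun _ => u) :=
    LFormula.canon_congr (by simp [fv_uclose])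
  rw [h, ← sat_model, ← LStructure.models_uclose]
  exact ⟨fun h => h _, fun h s =>
    (LStructure.Sat_congr V.model_isLStructure (by simp [fv_uclose])).1 h⟩

end LogValuation

theorem prov_of_consequence {T : Set LFormula} {φ : LFormula} (h : Consequence T φ) :
    Prov (HypAx T) (closedForm φ) := by
  by_contra hp
  obtain ⟨v, h1, h2, h3, h4⟩ := exists_valuation Set.subset_union_left hp
  let V : LogValuation := ⟨v, h1, h2, fun χ hχ => h3 χ (.inl hχ)⟩
  exact h4 ((V.models_model φ).1 (h V.model V.model_isLStructure fun σ hσ =>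
    (V.models_model σ).2 (h3 _ (.inr ⟨σ, hσ, rfl⟩))))

theorem consequence_iff_prov {T : Set LFormula} {φ : LFormula} :
    Consequence T φ ↔ Prov (HypAx T) (closedForm φ) :=
  ⟨prov_of_consequence, consequence_of_prov⟩

/-! ### Primitive recursion on terms and formulas -/

theorem Primrec.courseOfValues {α σ : Type*} [Primcodable α] [Primcodable σ] {f : α → ℕ → σ}
    {z : α → σ} {g : α × ℕ × σ × σ × σ → σ} (hz : Primrec z) (hg : Primrec g)
    (h0 : ∀ a, f a 0 = z a)
    (h1 : ∀ a n, f a (n + 1) =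
      g (a, n, f a (n / 4), f a (n / 4).unpair.1, f a (n / 4).unpair.2)) : Primrec₂ f := by
  let G : α → List σ → Option σ := fun a l => Nat.casesOn l.length (some (z a)) fun n =>
    (l[n / 4]?).bind fun x => (l[(n / 4).unpair.1]?).bind fun y =>
      (l[(n / 4).unpair.2]?).map fun w => g (a, n, x, y, w)
  have hG : Primrec₂ G := by
    refine Primrec.nat_casesOn (Primrec.list_length.comp Primrec.snd)
      (Primrec.option_some.comp (hz.comp Primrec.fst)) ?_
    have h4 : Primrec fun n : ℕ => n / 4 := Primrec.nat_div.comp Primrec.id (Primrec.const 4)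
    refine Primrec.option_bind (Primrec.list_getElem?.comp
      (Primrec.snd.comp Primrec.fst) (h4.comp Primrec.snd)) ?_
    refine Primrec.option_bind (Primrec.list_getElem?.comp
      (Primrec.snd.comp (Primrec.fst.comp Primrec.fst))
      (Primrec.fst.comp (Primrec.unpair.comp (h4.comp (Primrec.snd.comp Primrec.fst))))) ?_
    refine Primrec.option_map (Primrec.list_getElem?.comp
      (Primrec.snd.comp (Primrec.fst.comp (Primrec.fst.comp Primrec.fst)))
      (Primrec.snd.comp (Primrec.unpair.comp
        (h4.comp (Primrec.snd.comp (Primrec.fst.comp Primrec.fst)))))) ?_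
    refine hg.comp ?_
    have p1 := Primrec.fst (α := (((α × List σ) × ℕ) × σ) × σ) (β := σ)
    have p2 := Primrec.fst.comp p1
    have p3 := Primrec.fst.comp p2
    exact Primrec.pair (Primrec.fst.comp (Primrec.fst.comp p3))
      (Primrec.pair (Primrec.snd.comp p3) (Primrec.pair (Primrec.snd.comp p2)
        (Primrec.pair (Primrec.snd.comp p1) Primrec.snd)))
  refine Primrec.nat_strong_rec f hG fun a n => ?_
  cases n with
  | zero => simp [G, h0]
  | succ n =>
    have l0 : n / 4 < n + 1 := by omega
    have l1 := (Nat.unpair_left_le (n / 4)).trans_lt l0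
    have l2 := (Nat.unpair_right_le (n / 4)).trans_lt l0
    simp [G, h1, List.getElem?_map, l0, l1, l2]

namespace LTerm

/-- An enumeration of terms. -/
def toNat : LTerm → ℕ
  | zero => 0
  | var n => 4 * n + 1
  | succ t => 4 * t.toNat + 2
  | add t u => 4 * Nat.pair t.toNat u.toNat + 3
  | mul t u => 4 * Nat.pair t.toNat u.toNat + 4

/-- The inverse of `LTerm.toNat`. -/
def ofNat : ℕ → LTerm
  | 0 => zero
  | n + 1 =>
    have l0 : n / 4 < n + 1 := by omega
    have l1 := (Nat.unpair_left_le (n / 4)).trans_lt l0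
    have l2 := (Nat.unpair_right_le (n / 4)).trans_lt l0
    if n % 4 = 0 then var (n / 4)
    else if n % 4 = 1 then succ (ofNat (n / 4))
    else if n % 4 = 2 then add (ofNat (n / 4).unpair.1) (ofNat (n / 4).unpair.2)
    else mul (ofNat (n / 4).unpair.1) (ofNat (n / 4).unpair.2)

theorem ofNat_toNat (t : LTerm) : ofNat t.toNat = t := by
  have h : ∀ k i, i < 4 → (4 * k + i) / 4 = k ∧ (4 * k + i) % 4 = i := by omega
  induction t with
  | zero => simp [toNat, ofNat]
  | var n => simp [toNat, ofNat]
  | succ t ih => simp [toNat, ofNat, h, ih]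
  | add t u iht ihu => simp [toNat, ofNat, h, iht, ihu]
  | mul t u iht ihu => simp [toNat, ofNat, h, iht, ihu]

theorem toNat_ofNat (n : ℕ) : (ofNat n).toNat = n := by
  induction n using Nat.strong_induction_on with
  | _ n ih =>
    cases n with
    | zero => simp [toNat, ofNat]
    | succ n =>
      have l0 : n / 4 < n + 1 := by omega
      have i0 := ih _ l0
      have i1 := ih _ ((Nat.unpair_left_le (n / 4)).trans_lt l0)
      have i2 := ih _ ((Nat.unpair_right_le (n / 4)).trans_lt l0)
      rw [ofNat]
      split_ifs <;> simp only [toNat, i0, i1, i2, Nat.pair_unpair] <;> omega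

instance : Denumerable LTerm :=
  Denumerable.mk' ⟨toNat, ofNat, ofNat_toNat, toNat_ofNat⟩

theorem encode_eq (t : LTerm) : Encodable.encode t = t.toNat := rfl

theorem primrec_var : Primrec var := Primrec.encode_iff.1 <| by
  exact Primrec.nat_add.comp (Primrec.nat_mul.comp (Primrec.const 4) Primrec.id) (Primrec.const 1)

theorem primrec_succ : Primrec succ := Primrec.encode_iff.1 <| by
  exact Primrec.nat_add.comp (Primrec.nat_mul.comp (Primrec.const 4) Primrec.encode)
    (Primrec.const 2)

theorem primrec_add : Primrec₂ add := Primrec.encode_iff.1 <| by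
  exact Primrec.nat_add.comp (Primrec.nat_mul.comp (Primrec.const 4)
    (Primrec₂.natPair.comp (Primrec.encode.comp Primrec.fst) (Primrec.encode.comp Primrec.snd)))
    (Primrec.const 3)

theorem primrec_mul : Primrec₂ mul := Primrec.encode_iff.1 <| by
  exact Primrec.nat_add.comp (Primrec.nat_mul.comp (Primrec.const 4)
    (Primrec₂.natPair.comp (Primrec.encode.comp Primrec.fst) (Primrec.encode.comp Primrec.snd)))
    (Primrec.const 4)

section rec

variable {α σ : Type*} [Primcodable α] [Primcodable σ]

theorem primrec_rec {f : α → LTerm → σ} {fz : α → σ} {fv : α × ℕ → σ} {fs : α × σ → σ}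
    {fa fm : α × σ × σ → σ} (hz : Primrec fz) (hv : Primrec fv) (hs : Primrec fs)
    (ha : Primrec fa) (hm : Primrec fm)
    (h_zero : ∀ a, f a zero = fz a) (h_var : ∀ a n, f a (var n) = fv (a, n))
    (h_succ : ∀ a t, f a (succ t) = fs (a, f a t))
    (h_add : ∀ a t u, f a (add t u) = fa (a, f a t, f a u))
    (h_mul : ∀ a t u, f a (mul t u) = fm (a, f a t, f a u)) : Primrec₂ f := by
  have key : Primrec₂ fun a n => f a (ofNat n) := by
    refine Primrec.courseOfValues (z := fz) (g := fun p =>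
      if p.2.1 % 4 = 0 then fv (p.1, p.2.1 / 4) else
      if p.2.1 % 4 = 1 then fs (p.1, p.2.2.1) else
      if p.2.1 % 4 = 2 then fa (p.1, p.2.2.2) else fm (p.1, p.2.2.2))
      hz ?_ (fun a => by simp [ofNat, h_zero]) fun a n => ?_
    · have pn := Primrec.fst.comp (Primrec.snd (α := α) (β := ℕ × σ × σ × σ))
      have pr := Primrec.snd.comp (Primrec.snd (α := α) (β := ℕ × σ × σ × σ))
      have pm := Primrec.nat_mod.comp pn (Primrec.const 4)
      have pc : ∀ i : ℕ, PrimrecPred fun p : α × ℕ × σ × σ × σ => p.2.1 % 4 = i := fun i =>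
        Primrec.eq.comp pm (Primrec.const i)
      refine Primrec.ite (pc 0) (hv.comp (Primrec.pair Primrec.fst
        (Primrec.nat_div.comp pn (Primrec.const 4)))) ?_
      refine Primrec.ite (pc 1) (hs.comp (Primrec.pair Primrec.fst (Primrec.fst.comp pr))) ?_
      exact Primrec.ite (pc 2) (ha.comp (Primrec.pair Primrec.fst (Primrec.snd.comp pr)))
        (hm.comp (Primrec.pair Primrec.fst (Primrec.snd.comp pr)))
    · rw [ofNat]
      split_ifs <;> simp [h_var, h_succ, h_add, h_mul]
  have := key.comp Primrec.fst (Primrec.encode.comp (Primrec.snd (α := α) (β := LTerm)))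
  exact this.of_eq fun p => by simp [encode_eq, ofNat_toNat]

end rec

end LTerm

namespace LFormula

/-- An enumeration of formulas. -/
def toNat : LFormula → ℕ
  | falsum => 0
  | eq t u => 4 * Nat.pair t.toNat u.toNat + 1
  | imp a b => 4 * Nat.pair a.toNat b.toNat + 2
  | all x a => 4 * Nat.pair x a.toNat + 3
  | K a => 4 * a.toNat + 4

/-- The inverse of `LFormula.toNat`. -/
def ofNat : ℕ → LFormula
  | 0 => falsum
  | n + 1 =>
    have l0 : n / 4 < n + 1 := by omega
    have l1 := (Nat.unpair_left_le (n / 4)).trans_lt l0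
    have l2 := (Nat.unpair_right_le (n / 4)).trans_lt l0
    if n % 4 = 0 then eq (LTerm.ofNat (n / 4).unpair.1) (LTerm.ofNat (n / 4).unpair.2)
    else if n % 4 = 1 then imp (ofNat (n / 4).unpair.1) (ofNat (n / 4).unpair.2)
    else if n % 4 = 2 then all (n / 4).unpair.1 (ofNat (n / 4).unpair.2)
    else K (ofNat (n / 4))

theorem ofNat_toNat (φ : LFormula) : ofNat φ.toNat = φ := by
  have h : ∀ k i, i < 4 → (4 * k + i) / 4 = k ∧ (4 * k + i) % 4 = i := by omega
  induction φ with
  | falsum => simp [toNat, ofNat]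
  | eq t u => simp [toNat, ofNat, LTerm.ofNat_toNat]
  | imp a b iha ihb => simp [toNat, ofNat, h, iha, ihb]
  | all x a ih => simp [toNat, ofNat, h, ih]
  | K a ih => simp [toNat, ofNat, h, ih]

theorem toNat_ofNat (n : ℕ) : (ofNat n).toNat = n := by
  induction n using Nat.strong_induction_on with
  | _ n ih =>
    cases n with
    | zero => simp [toNat, ofNat]
    | succ n =>
      have l0 : n / 4 < n + 1 := by omega
      have i0 := ih _ l0
      have i1 := ih _ ((Nat.unpair_left_le (n / 4)).trans_lt l0)
      have i2 := ih _ ((Nat.unpair_right_le (n / 4)).trans_lt l0)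
      rw [ofNat]
      split_ifs <;> simp only [toNat, i0, i1, i2, LTerm.toNat_ofNat, Nat.pair_unpair] <;> omega

instance : Denumerable LFormula :=
  Denumerable.mk' ⟨toNat, ofNat, ofNat_toNat, toNat_ofNat⟩

theorem encode_eq (φ : LFormula) : Encodable.encode φ = φ.toNat := rfl

theorem primrec_eq : Primrec₂ eq := Primrec.encode_iff.1 <| by
  exact Primrec.nat_add.comp (Primrec.nat_mul.comp (Primrec.const 4)
    (Primrec₂.natPair.comp (Primrec.encode.comp Primrec.fst) (Primrec.encode.comp Primrec.snd)))
    (Primrec.const 1)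

theorem primrec_imp : Primrec₂ imp := Primrec.encode_iff.1 <| by
  exact Primrec.nat_add.comp (Primrec.nat_mul.comp (Primrec.const 4)
    (Primrec₂.natPair.comp (Primrec.encode.comp Primrec.fst) (Primrec.encode.comp Primrec.snd)))
    (Primrec.const 2)

theorem primrec_all : Primrec₂ all := Primrec.encode_iff.1 <| by
  exact Primrec.nat_add.comp (Primrec.nat_mul.comp (Primrec.const 4)
    (Primrec₂.natPair.comp Primrec.fst (Primrec.encode.comp Primrec.snd)))
    (Primrec.const 3)

theorem primrec_K : Primrec K := Primrec.encode_iff.1 <| by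
  exact Primrec.nat_add.comp (Primrec.nat_mul.comp (Primrec.const 4) Primrec.encode)
    (Primrec.const 4)

theorem primrec_ofNat : Primrec ofNat := Primrec.ofNat LFormula

section rec

variable {α σ : Type*} [Primcodable α] [Primcodable σ]

theorem primrec_rec {f : α → LFormula → σ} {ff : α → σ} {fe : α × LTerm × LTerm → σ}
    {fi : α × σ × σ → σ} {fa : α × ℕ × LFormula × σ → σ} {fk : α × σ → σ}
    (hf : Primrec ff) (he : Primrec fe) (hi : Primrec fi) (ha : Primrec fa) (hk : Primrec fk)
    (h_falsum : ∀ a, f a falsum = ff a) (h_eq : ∀ a t u, f a (eq t u) = fe (a, t, u))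
    (h_imp : ∀ a φ ψ, f a (imp φ ψ) = fi (a, f a φ, f a ψ))
    (h_all : ∀ a x φ, f a (all x φ) = fa (a, x, φ, f a φ))
    (h_K : ∀ a φ, f a (K φ) = fk (a, f a φ)) : Primrec₂ f := by
  have key : Primrec₂ fun a n => f a (ofNat n) := by
    refine Primrec.courseOfValues (z := ff) (g := fun p =>
      if p.2.1 % 4 = 0 then fe (p.1, LTerm.ofNat (p.2.1 / 4).unpair.1,
        LTerm.ofNat (p.2.1 / 4).unpair.2) else
      if p.2.1 % 4 = 1 then fi (p.1, p.2.2.2) else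
      if p.2.1 % 4 = 2 then fa (p.1, (p.2.1 / 4).unpair.1, ofNat (p.2.1 / 4).unpair.2,
        p.2.2.2.2) else fk (p.1, p.2.2.1))
      hf ?_ (fun a => by simp [ofNat, h_falsum]) fun a n => ?_
    · have pn := Primrec.fst.comp (Primrec.snd (α := α) (β := ℕ × σ × σ × σ))
      have pr := Primrec.snd.comp (Primrec.snd (α := α) (β := ℕ × σ × σ × σ))
      have pm := Primrec.nat_mod.comp pn (Primrec.const 4)
      have pc : ∀ i : ℕ, PrimrecPred fun p : α × ℕ × σ × σ × σ => p.2.1 % 4 = i := fun i =>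
        Primrec.eq.comp pm (Primrec.const i)
      have pu := Primrec.unpair.comp (Primrec.nat_div.comp pn (Primrec.const 4))
      have p1 := Primrec.fst.comp pu
      have p2 := Primrec.snd.comp pu
      have po := Primrec.ofNat LTerm
      refine Primrec.ite (pc 0) (he.comp (Primrec.pair Primrec.fst
        (Primrec.pair (po.comp p1) (po.comp p2)))) ?_
      refine Primrec.ite (pc 1) (hi.comp (Primrec.pair Primrec.fst (Primrec.snd.comp pr))) ?_
      exact Primrec.ite (pc 2) (ha.comp (Primrec.pair Primrec.fst (Primrec.pair p1
          (Primrec.pair (primrec_ofNat.comp p2) (Primrec.snd.comp (Primrec.snd.comp pr))))))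
        (hk.comp (Primrec.pair Primrec.fst (Primrec.fst.comp pr)))
    · rw [ofNat]
      split_ifs <;> simp [h_eq, h_imp, h_all, h_K]
  have := key.comp Primrec.fst (Primrec.encode.comp (Primrec.snd (α := α) (β := LFormula)))
  exact this.of_eq fun p => by simp [encode_eq, ofNat_toNat]

end rec

end LFormula

/-! ### Primitive recursiveness of the syntactic operations -/

theorem primrec_numeral : Primrec numeral := by
  refine (Primrec.nat_iterate Primrec.id (Primrec.const LTerm.zero)
    (LTerm.primrec_succ.comp Primrec.snd).to₂).of_eq fun n => ?_
  induction n with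
  | zero => rfl
  | succ n ih =>
    simp only [id] at ih ⊢
    rw [Function.iterate_succ_apply', ih, numeral]

theorem LTerm.primrec_mem_fv : Primrec₂ fun (x : ℕ) (t : LTerm) => decide (x ∈ t.fv) := by
  have h : Primrec fun p : ℕ × Bool × Bool => p.2.1 || p.2.2 :=
    Primrec.or.comp (Primrec.fst.comp Primrec.snd) (Primrec.snd.comp Primrec.snd)
  refine LTerm.primrec_rec (fv := fun p => decide (p.1 = p.2)) (Primrec.const false)
    (Primrec.eq.decide.comp Primrec.fst Primrec.snd) Primrec.snd h h ?_ ?_ ?_ ?_ ?_ <;>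
  simp [LTerm.fv]
  exact fun _ _ => rfl

theorem LFormula.primrec_mem_fv :
    Primrec₂ fun (x : ℕ) (φ : LFormula) => decide (x ∈ φ.fv) := by
  refine LFormula.primrec_rec (fe := fun p => decide (p.1 ∈ p.2.1.fv) || decide (p.1 ∈ p.2.2.fv))
    (fi := fun p => p.2.1 || p.2.2) (fa := fun p => !(decide (p.1 = p.2.1)) && p.2.2.2)
    (Primrec.const false)
    (Primrec.or.comp (LTerm.primrec_mem_fv.comp Primrec.fst (Primrec.fst.comp Primrec.snd))
      (LTerm.primrec_mem_fv.comp Primrec.fst (Primrec.snd.comp Primrec.snd)))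
    (Primrec.or.comp (Primrec.fst.comp Primrec.snd) (Primrec.snd.comp Primrec.snd))
    (Primrec.and.comp (Primrec.not.comp
      (Primrec.eq.decide.comp Primrec.fst (Primrec.fst.comp Primrec.snd)))
      (Primrec.snd.comp (Primrec.snd.comp Primrec.snd)))
    Primrec.snd ?_ ?_ ?_ ?_ ?_ <;>
  simp [LFormula.fv]
  exact fun _ _ => rfl

theorem LFormula.primrec_mem_bv :
    Primrec₂ fun (x : ℕ) (φ : LFormula) => decide (x ∈ φ.bv) := by
  refine LFormula.primrec_rec (fe := fun _ => false)
    (fi := fun p => p.2.1 || p.2.2) (fa := fun p => decide (p.1 = p.2.1) || p.2.2.2)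
    (Primrec.const false) (Primrec.const false)
    (Primrec.or.comp (Primrec.fst.comp Primrec.snd) (Primrec.snd.comp Primrec.snd))
    (Primrec.or.comp (Primrec.eq.decide.comp Primrec.fst (Primrec.fst.comp Primrec.snd))
      (Primrec.snd.comp (Primrec.snd.comp Primrec.snd)))
    Primrec.snd ?_ ?_ ?_ ?_ ?_ <;>
  simp [LFormula.bv]
  exact fun _ _ => rfl

theorem LFormula.primrec_ht : Primrec LFormula.ht := by
  have : Primrec₂ fun (_ : Unit) (φ : LFormula) => φ.ht := by
    refine LFormula.primrec_rec (fe := fun _ => 0)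
      (fi := fun p => max p.2.1 p.2.2) (fa := fun p => p.2.2.2 + 1)
      (Primrec.const 0) (Primrec.const 0)
      (Primrec.nat_max.comp (Primrec.fst.comp Primrec.snd) (Primrec.snd.comp Primrec.snd))
      (Primrec.succ.comp (Primrec.snd.comp (Primrec.snd.comp Primrec.snd)))
      Primrec.snd ?_ ?_ ?_ ?_ ?_ <;>
    simp [LFormula.ht]
  exact this.comp (Primrec.const ()) Primrec.id

theorem LTerm.primrec_subst1 : Primrec₂ fun (p : ℕ × LTerm) (u : LTerm) =>
    u.subst fun z => if z = p.1 then p.2 else LTerm.var z := by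
  refine LTerm.primrec_rec (fv := fun q => if q.2 = q.1.1 then q.1.2 else LTerm.var q.2)
    (Primrec.const LTerm.zero)
    (Primrec.ite (Primrec.eq.comp Primrec.snd (Primrec.fst.comp Primrec.fst))
      (Primrec.snd.comp Primrec.fst) (LTerm.primrec_var.comp Primrec.snd))
    (LTerm.primrec_succ.comp Primrec.snd)
    (LTerm.primrec_add.comp (Primrec.fst.comp Primrec.snd) (Primrec.snd.comp Primrec.snd))
    (LTerm.primrec_mul.comp (Primrec.fst.comp Primrec.snd) (Primrec.snd.comp Primrec.snd))
    ?_ ?_ ?_ ?_ ?_ <;>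
  intros <;> rfl

theorem primrec_subst1 : Primrec₂ fun (p : ℕ × LTerm) (φ : LFormula) => subst1 p.1 p.2 φ := by
  refine LFormula.primrec_rec
    (fa := fun q => if q.2.1 = q.1.1 then .all q.2.1 q.2.2.1 else .all q.2.1 q.2.2.2)
    (Primrec.const LFormula.falsum)
    (LFormula.primrec_eq.comp
      (LTerm.primrec_subst1.comp Primrec.fst (Primrec.fst.comp Primrec.snd))
      (LTerm.primrec_subst1.comp Primrec.fst (Primrec.snd.comp Primrec.snd)))
    (LFormula.primrec_imp.comp (Primrec.fst.comp Primrec.snd) (Primrec.snd.comp Primrec.snd))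
    (Primrec.ite (Primrec.eq.comp (Primrec.fst.comp Primrec.snd) (Primrec.fst.comp Primrec.fst))
      (LFormula.primrec_all.comp (Primrec.fst.comp Primrec.snd)
        (Primrec.fst.comp (Primrec.snd.comp Primrec.snd)))
      (LFormula.primrec_all.comp (Primrec.fst.comp Primrec.snd)
        (Primrec.snd.comp (Primrec.snd.comp Primrec.snd))))
    (LFormula.primrec_K.comp Primrec.snd) ?_ ?_ ?_ (fun _ _ _ => subst1_all _ _ _ _) ?_ <;>
  intros <;> rfl

theorem primrec_oddVar : Primrec oddVar :=
  Primrec.nat_add.comp (Primrec.nat_mul.comp (Primrec.const 2) Primrec.id) (Primrec.const 1)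

theorem LTerm.primrec_rename_oddVar : Primrec fun t : LTerm => t.rename oddVar := by
  have : Primrec₂ fun (_ : Unit) (t : LTerm) => t.rename oddVar := by
    refine LTerm.primrec_rec (Primrec.const LTerm.zero)
      (LTerm.primrec_var.comp (primrec_oddVar.comp Primrec.snd))
      (LTerm.primrec_succ.comp Primrec.snd)
      (LTerm.primrec_add.comp (Primrec.fst.comp Primrec.snd) (Primrec.snd.comp Primrec.snd))
      (LTerm.primrec_mul.comp (Primrec.fst.comp Primrec.snd) (Primrec.snd.comp Primrec.snd))
      ?_ ?_ ?_ ?_ ?_ <;>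
    intros <;> rfl
  exact this.comp (Primrec.const ()) Primrec.id

theorem LFormula.canon_oddVar_all (x : ℕ) (a : LFormula) : (LFormula.all x a).canon oddVar =
    .all (2 * a.ht) (subst1 (oddVar x) (.var (2 * a.ht)) (a.canon oddVar)) := by
  rw [LFormula.subst1_canon fun i _ => by simp only [oddVar]; omega, LFormula.canon]
  congr 2
  funext u
  by_cases hu : u = x
  · simp [hu]
  · have : oddVar u ≠ oddVar x := by simp only [oddVar]; omega
    simp [hu, this]

theorem LFormula.primrec_canon_oddVar : Primrec fun φ : LFormula => φ.canon oddVar := by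
  have : Primrec₂ fun (_ : Unit) (φ : LFormula) => φ.canon oddVar := by
    have pd : Primrec fun q : Unit × ℕ × LFormula × LFormula => 2 * q.2.2.1.ht :=
      Primrec.nat_mul.comp (Primrec.const 2)
        (LFormula.primrec_ht.comp (Primrec.fst.comp (Primrec.snd.comp Primrec.snd)))
    refine LFormula.primrec_rec
      (fa := fun q => .all (2 * q.2.2.1.ht)
        (subst1 (oddVar q.2.1) (.var (2 * q.2.2.1.ht)) q.2.2.2))
      (Primrec.const LFormula.falsum)
      (LFormula.primrec_eq.comp
        (LTerm.primrec_rename_oddVar.comp (Primrec.fst.comp Primrec.snd))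
        (LTerm.primrec_rename_oddVar.comp (Primrec.snd.comp Primrec.snd)))
      (LFormula.primrec_imp.comp (Primrec.fst.comp Primrec.snd) (Primrec.snd.comp Primrec.snd))
      (LFormula.primrec_all.comp pd (primrec_subst1.comp
        (Primrec.pair (primrec_oddVar.comp (Primrec.fst.comp Primrec.snd))
          (LTerm.primrec_var.comp pd))
        (Primrec.snd.comp (Primrec.snd.comp Primrec.snd))))
      (LFormula.primrec_K.comp Primrec.snd) ?_ ?_ ?_
      (fun _ _ _ => LFormula.canon_oddVar_all _ _) ?_ <;>
    intros <;> rfl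
  exact this.comp (Primrec.const ()) Primrec.id

theorem LTerm.primrec_gnum : Primrec LTerm.gnum := by
  have : Primrec₂ fun (_ : Unit) (t : LTerm) => t.gnum := by
    have h : ∀ i : ℕ, Primrec fun p : Unit × ℕ × ℕ => Nat.pair i (Nat.pair p.2.1 p.2.2) :=
      fun i => Primrec₂.natPair.comp (Primrec.const i)
        (Primrec₂.natPair.comp (Primrec.fst.comp Primrec.snd) (Primrec.snd.comp Primrec.snd))
    refine LTerm.primrec_rec (Primrec.const (Nat.pair 1 0))
      (Primrec₂.natPair.comp (Primrec.const 0) Primrec.snd)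
      (Primrec₂.natPair.comp (Primrec.const 2) Primrec.snd) (h 3) (h 4) ?_ ?_ ?_ ?_ ?_ <;>
    intros <;> rfl
  exact this.comp (Primrec.const ()) Primrec.id

theorem LFormula.primrec_gnum : Primrec LFormula.gnum := by
  have : Primrec₂ fun (_ : Unit) (φ : LFormula) => φ.gnum := by
    refine LFormula.primrec_rec (Primrec.const (Nat.pair 1 0))
      (Primrec₂.natPair.comp (Primrec.const 0) (Primrec₂.natPair.comp
        (LTerm.primrec_gnum.comp (Primrec.fst.comp Primrec.snd))
        (LTerm.primrec_gnum.comp (Primrec.snd.comp Primrec.snd))))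
      (Primrec₂.natPair.comp (Primrec.const 2)
        (Primrec₂.natPair.comp (Primrec.fst.comp Primrec.snd) (Primrec.snd.comp Primrec.snd)))
      (Primrec₂.natPair.comp (Primrec.const 3)
        (Primrec₂.natPair.comp (Primrec.fst.comp Primrec.snd)
          (Primrec.snd.comp (Primrec.snd.comp Primrec.snd))))
      (Primrec₂.natPair.comp (Primrec.const 4) Primrec.snd) ?_ ?_ ?_ ?_ ?_ <;>
    intros <;> rfl
  exact this.comp (Primrec.const ()) Primrec.id

theorem LFormula.sort_fv (φ : LFormula) : φ.fv.sort (· ≤ ·) =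
    (List.range (φ.gnum + 1)).filter fun x => decide (x ∈ φ.fv) := by
  refine List.Perm.eq_of_pairwise' (r := (· ≤ ·)) ?_ ?_ ?_
  · exact Finset.pairwise_sort _ _
  · exact (List.pairwise_lt_range.imp le_of_lt).filter _
  · refine (List.perm_ext_iff_of_nodup (Finset.sort_nodup _ _)
      (List.nodup_range.filter _)).2 fun x => ?_
    have := LFormula.le_gnum (x := x) (φ := φ)
    simp only [Finset.mem_sort, List.mem_filter, List.mem_range, decide_eq_true_eq]
    grind

theorem primrec_uclose : Primrec uclose := by
  have hl : Primrec fun φ : LFormula =>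
      (List.range (φ.gnum + 1)).filter fun x => decide (x ∈ φ.fv) := by
    have hrel : PrimrecRel fun (x : ℕ) (φ : LFormula) => x ∈ φ.fv :=
      LFormula.primrec_mem_fv.primrecRel
    exact (hrel.listFilter).comp (Primrec.list_range.comp
      (Primrec.succ.comp LFormula.primrec_gnum)) Primrec.id
  refine (Primrec.list_foldr hl Primrec.id
    (LFormula.primrec_all.comp Primrec.fst Primrec.snd |>.comp Primrec.snd).to₂).of_eq fun φ => ?_
  rw [uclose, LFormula.sort_fv]
  rfl

theorem primrec_closedForm : Primrec closedForm :=
  LFormula.primrec_canon_oddVar.comp primrec_uclose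

theorem primrec_henkinVar : Primrec₂ henkinVar :=
  Primrec.nat_add.comp (Primrec.nat_mul.comp (Primrec.const 2)
    (LFormula.primrec_gnum.comp (LFormula.primrec_all.comp Primrec.fst Primrec.snd)))
    (Primrec.const 1)

/-- Successive substitution of the numerals of `l` for the variables up to `φ.gnum`. -/
def instList (l : List ℕ) (φ : LFormula) : LFormula :=
  (List.range (φ.gnum + 1)).foldl (fun ψ i => subst1 i (numeral (l.getD i 0)) ψ) φ

theorem LFormula.subst_subst_numeral (f : ℕ → ℕ) (A : ℕ → Prop) [DecidablePred A] (i : ℕ)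
    (φ : LFormula) :
    subst1 i (numeral (f i)) (φ.subst fun z => if A z then numeral (f z) else .var z) =
      φ.subst fun z => if A z ∨ z = i then numeral (f z) else .var z := by
  induction φ generalizing A with
  | eq t u =>
    simp only [subst1, subst, LTerm.subst_subst]
    congr 2 <;>
    · funext z
      by_cases hz : A z
      · simp [hz, numeral_subst]
      · by_cases hi : z = i
        · simp only [or_true, hi, if_true]
          rw [if_neg (hi ▸ hz)]
          simp [LTerm.subst]
        · simp [hz, hi, LTerm.subst]
  | falsum => rfl
  | imp a b iha ihb => exact congrArg₂ imp (iha A) (ihb A)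
  | all x a ih =>
    have h1 : ∀ (P : ℕ → Prop) [DecidablePred P],
        (fun z => if z = x then LTerm.var x else if P z then numeral (f z) else .var z) =
        fun z => if (P z ∧ z ≠ x) then numeral (f z) else .var z := by
      intro P _
      funext z
      by_cases hz : z = x <;> simp [hz]
    simp only [subst, h1]
    rw [subst1_all, ih]
    split_ifs with hx
    · congr 2
      funext z
      by_cases hz : z = x <;> simp [hz, ← hx]
    · congr 2
      funext z
      by_cases hz : z = x <;> simp [hz, hx]
  | K a ih => exact congrArg K (ih A)

theorem instList_eq (l : List ℕ) (φ : LFormula) :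
    instList l φ = instNum (fun z => l.getD z 0) φ := by
  have key : ∀ n, (List.range n).foldl (fun ψ i => subst1 i (numeral (l.getD i 0)) ψ) φ =
      φ.subst fun z => if z < n then numeral (l.getD z 0) else .var z := by
    intro n
    induction n with
    | zero => simp [LFormula.subst_var]
    | succ n ih =>
      rw [List.range_succ, List.foldl_append, ih]
      simp only [List.foldl_cons, List.foldl_nil]
      rw [LFormula.subst_subst_numeral (fun z => l.getD z 0) (· < n) n]
      congr 1
      funext z
      simp only [Nat.lt_succ_iff_lt_or_eq]
  rw [instList, key, instNum]
  refine LFormula.subst_congr fun x hx => ?_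
  rw [if_pos (Nat.lt_succ_of_le (LFormula.le_gnum (.inl hx)))]

theorem exists_instList (s : ℕ → ℕ) (φ : LFormula) : ∃ l, instNum s φ = instList l φ := by
  refine ⟨(List.range (φ.gnum + 1)).map s, ?_⟩
  rw [instList_eq]
  refine LFormula.subst_congr fun x hx => ?_
  have := Nat.lt_succ_of_le (LFormula.le_gnum (.inl hx))
  simp [List.getD_eq_getElem?_getD, this]

theorem primrec_instList : Primrec₂ instList := by
  have h1 : Primrec fun p : (List ℕ × LFormula) × LFormula × ℕ => p.2.2 :=
    Primrec.snd.comp Primrec.snd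
  have h2 : Primrec fun p : (List ℕ × LFormula) × LFormula × ℕ => p.1.1 :=
    Primrec.fst.comp Primrec.fst
  exact Primrec.list_foldl (Primrec.list_range.comp
    (Primrec.succ.comp (LFormula.primrec_gnum.comp Primrec.snd))) Primrec.snd
    (primrec_subst1.comp (Primrec.pair h1 (primrec_numeral.comp
      ((Primrec.list_getD 0).comp h2 h1))) (Primrec.fst.comp Primrec.snd)).to₂

theorem primrec_notF : Primrec notF := LFormula.primrec_imp.comp Primrec.id (Primrec.const _)

theorem primrec_andF : Primrec₂ andF :=
  primrec_notF.comp (LFormula.primrec_imp.comp Primrec.fst (primrec_notF.comp Primrec.snd))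

theorem primrec_iffF : Primrec₂ iffF :=
  primrec_andF.comp (LFormula.primrec_imp.comp Primrec.fst Primrec.snd)
    (LFormula.primrec_imp.comp Primrec.snd Primrec.fst)

theorem primrec_line3 (pw : LFormula) : Primrec₂ (line3 pw) :=
  LFormula.primrec_all.comp (Primrec.const vx) (primrec_iffF.comp
    (LFormula.primrec_K.comp Primrec.snd)
    (primrec_subst1.comp (Primrec.pair (Primrec.const ve) (primrec_numeral.comp Primrec.fst))
      (primrec_subst1.comp (Primrec.pair (Primrec.const vy)
        (primrec_numeral.comp (LFormula.primrec_gnum.comp Primrec.snd))) (Primrec.const pw))))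

theorem LFormula.primrecPred_fv_subset (x : ℕ) : PrimrecPred fun φ : LFormula => φ.fv ⊆ {x} := by
  have h1 : PrimrecRel fun (z : ℕ) (φ : LFormula) => z ∈ φ.fv :=
    LFormula.primrec_mem_fv.primrecRel
  have h2 : PrimrecRel fun (z : ℕ) (_ : LFormula) => z = x :=
    Primrec.eq.comp₂ Primrec₂.left (Primrec₂.const x)
  have h3 : PrimrecRel fun (z : ℕ) (φ : LFormula) => z ∉ φ.fv ∨ z = x :=
    PrimrecPred.or h1.not h2
  refine (h3.forall_mem_list.comp (Primrec.list_range.comp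
    (Primrec.succ.comp LFormula.primrec_gnum)) Primrec.id).of_eq fun φ => ?_
  have := fun x => LFormula.le_gnum (x := x) (φ := φ)
  simp only [List.mem_range, id, Finset.subset_singleton_iff']
  grind

/-! ### Semidecidability -/

/-- A predicate is semidecidable if it is a projection of a primitive recursive relation. -/
def SemiDec {α : Type*} [Primcodable α] (p : α → Prop) : Prop :=
  ∃ q : α → ℕ → Bool, Primrec₂ q ∧ ∀ a, p a ↔ ∃ n, q a n = true

namespace SemiDec

variable {α β : Type*} [Primcodable α] [Primcodable β] {p r : α → Prop}

theorem of_eq (h : SemiDec p) (H : ∀ a, p a ↔ r a) : SemiDec r := by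
  rwa [← funext fun a => propext (H a)]

theorem of_primrecPred (h : PrimrecPred p) : SemiDec p := by
  obtain ⟨_, h⟩ := h
  exact ⟨fun a _ => decide (p a), h.comp Primrec.fst, fun a => by simp⟩

theorem of_eq_primrec [DecidableEq β] {f g : α → β} (hf : Primrec f) (hg : Primrec g) :
    SemiDec fun a => f a = g a :=
  of_primrecPred (Primrec.eq.comp hf hg)

theorem comp (h : SemiDec p) {f : β → α} (hf : Primrec f) : SemiDec fun b => p (f b) := by
  obtain ⟨q, hq, h⟩ := h
  exact ⟨fun b => q (f b), hq.comp (hf.comp Primrec.fst) Primrec.snd, fun b => h _⟩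

theorem or (hp : SemiDec p) (hr : SemiDec r) : SemiDec fun a => p a ∨ r a := by
  obtain ⟨q, hq, h⟩ := hp
  obtain ⟨q', hq', h'⟩ := hr
  exact ⟨fun a n => q a n || q' a n, Primrec.or.comp hq hq', fun a => by
    simp [h, h', exists_or]⟩

theorem and (hp : SemiDec p) (hr : SemiDec r) : SemiDec fun a => p a ∧ r a := by
  obtain ⟨q, hq, h⟩ := hp
  obtain ⟨q', hq', h'⟩ := hr
  have hu := Primrec.unpair.comp (Primrec.snd (α := α) (β := ℕ))
  refine ⟨fun a n => q a n.unpair.1 && q' a n.unpair.2,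
    Primrec.and.comp (hq.comp Primrec.fst (Primrec.fst.comp hu))
      (hq'.comp Primrec.fst (Primrec.snd.comp hu)), fun a => ?_⟩
  simp only [h, h']
  constructor
  · rintro ⟨⟨n, hn⟩, m, hm⟩
    exact ⟨Nat.pair n m, by simp [hn, hm]⟩
  · rintro ⟨n, hn⟩
    rw [Bool.and_eq_true] at hn
    exact ⟨⟨_, hn.1⟩, _, hn.2⟩

theorem ex {p : α × β → Prop} (hp : SemiDec p) : SemiDec fun a => ∃ b, p (a, b) := by
  obtain ⟨q, hq, h⟩ := hp
  have hu := Primrec.unpair.comp (Primrec.snd (α := α) (β := ℕ))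
  refine ⟨fun a n => ((Encodable.decode (α := β) n.unpair.1).map fun b =>
    q (a, b) n.unpair.2).getD false, ?_, fun a => ?_⟩
  · refine Primrec.option_getD.comp (Primrec.option_map
      (Primrec.decode.comp (Primrec.fst.comp hu)) ?_) (Primrec.const false)
    exact (hq.comp (Primrec.pair (Primrec.fst.comp Primrec.fst) Primrec.snd)
      (Primrec.snd.comp (hu.comp Primrec.fst)))
  · simp only [h]
    constructor
    · rintro ⟨b, n, hn⟩
      exact ⟨Nat.pair (Encodable.encode b) n, by simp [hn]⟩
    · rintro ⟨n, hn⟩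
      cases hb : (Encodable.decode n.unpair.1 : Option β) with
      | none => simp [hb] at hn
      | some b => exact ⟨b, n.unpair.2, by simpa [hb] using hn⟩

/-- The image of a semidecidable predicate under a primitive recursive function. -/
theorem image [DecidableEq α] {γ : Type*} [Primcodable γ] {g : γ → α}
    {s : γ → Prop} (hs : SemiDec s) (hg : Primrec g) :
    SemiDec fun a => ∃ c, s c ∧ a = g c :=
  SemiDec.ex ((hs.comp Primrec.snd).and
    (of_eq_primrec Primrec.fst (hg.comp Primrec.snd)))

theorem range [DecidableEq α] {γ : Type*} [Primcodable γ] {g : γ → α} (hg : Primrec g) :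
    SemiDec fun a => ∃ c, a = g c :=
  (image (s := fun _ : γ => 0 = 0) (of_eq_primrec (Primrec.const 0) (Primrec.const 0)) hg).of_eq
    fun a => by simp

end SemiDec

theorem primrecRel_mem_list {α : Type*} [Primcodable α] [DecidableEq α] :
    PrimrecRel fun (a : α) (l : List α) => a ∈ l := by
  have : PrimrecRel fun (l : List α) (a : α) => ∃ b ∈ l, b = a :=
    PrimrecRel.exists_mem_list (R := fun b a => b = a) Primrec.eq
  exact this.swap.of_eq fun a l => by simp

/-- One step in the verification of a derivation: `i.2.1` is inferred by modus ponens from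
`i.1` if possible, and `i.1` is added if the test `q` accepts it. -/
def provStep (q : LFormula → ℕ → Bool) (l : List LFormula) (i : LFormula × LFormula × ℕ) :
    List LFormula :=
  (bif q i.1 i.2.2 then [i.1] else []) ++
    ((if .imp i.1 i.2.1 ∈ l ∧ i.1 ∈ l then [i.2.1] else []) ++ l)

theorem prov_iff_exists_foldl {Γ : Set LFormula} {q : LFormula → ℕ → Bool}
    (hq : ∀ χ, χ ∈ Γ ↔ ∃ n, q χ n = true) {φ : LFormula} :
    Prov Γ φ ↔ ∃ L, φ ∈ List.foldl (provStep q) [] L := by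
  have hmono : ∀ L l χ, χ ∈ l → χ ∈ List.foldl (provStep q) l L := by
    intro L
    induction L with
    | nil => exact fun _ _ h => h
    | cons i L ih => exact fun l χ h => ih _ _ (by simp [provStep, h])
  constructor
  · suffices H : Prov Γ φ → ∃ L, ∀ l, φ ∈ List.foldl (provStep q) l L from fun h =>
      (H h).imp fun L hL => hL []
    intro h
    induction h with
    | @ax φ h =>
      obtain ⟨n, hn⟩ := (hq φ).1 h
      exact ⟨[(φ, φ, n)], fun l => by simp [provStep, hn]⟩
    | @mp φ ψ _ _ ih ih' =>
      obtain ⟨L, hL⟩ := ih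
      obtain ⟨L', hL'⟩ := ih'
      refine ⟨L ++ L' ++ [(φ, ψ, 0)], fun l => ?_⟩
      rw [List.foldl_append, List.foldl_append]
      have h1 := hmono L' _ _ (hL l)
      have h2 := hL' (List.foldl (provStep q) l L)
      simp [provStep, h1, h2]
  · suffices H : ∀ L l, (∀ χ ∈ l, Prov Γ χ) → ∀ χ ∈ List.foldl (provStep q) l L, Prov Γ χ by
      rintro ⟨L, hL⟩
      exact H L [] (by simp) _ hL
    intro L
    induction L with
    | nil => exact fun _ h => h
    | cons i L ih =>
      refine fun l hl => ih _ fun χ hχ => ?_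
      simp only [provStep, List.mem_append] at hχ
      rcases hχ with hχ | hχ | hχ
      · cases hb : q i.1 i.2.2 with
        | false => simp [hb] at hχ
        | true =>
          simp only [hb, cond_true, List.mem_singleton] at hχ
          exact .ax ((hq _).2 ⟨_, hχ ▸ hb⟩)
      · split_ifs at hχ with hc
        · rw [List.mem_singleton] at hχ
          exact hχ ▸ .mp (hl _ hc.1) (hl _ hc.2)
        · simp at hχ
      · exact hl _ hχ

namespace SemiDec

variable {α : Type*} [Primcodable α]

theorem prov {T : α → Set LFormula} (hT : SemiDec fun x : α × LFormula => x.2 ∈ T x.1) :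
    SemiDec fun x : α × LFormula => Prov (T x.1) x.2 := by
  obtain ⟨q, hq, h⟩ := hT
  have H : ∀ x : α × LFormula, Prov (T x.1) x.2 ↔
      ∃ L, x.2 ∈ List.foldl (provStep fun χ n => q (x.1, χ) n) [] L := fun x =>
    prov_iff_exists_foldl fun χ => h (x.1, χ)
  refine of_eq ?_ fun x => (H x).symm
  have hstep : Primrec₂ fun (x : (α × LFormula) × List (LFormula × LFormula × ℕ))
      (p : List LFormula × LFormula × LFormula × ℕ) =>
      provStep (fun χ n => q (x.1.1, χ) n) p.1 p.2 := by
    have ha : Primrec fun y : ((α × LFormula) × List (LFormula × LFormula × ℕ)) ×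
        List LFormula × LFormula × LFormula × ℕ => y.1.1.1 :=
      Primrec.fst.comp (Primrec.fst.comp Primrec.fst)
    have hi := Primrec.snd.comp (Primrec.snd
      (α := (α × LFormula) × List (LFormula × LFormula × ℕ))
      (β := List LFormula × LFormula × LFormula × ℕ))
    have hl := Primrec.fst.comp (Primrec.snd
      (α := (α × LFormula) × List (LFormula × LFormula × ℕ))
      (β := List LFormula × LFormula × LFormula × ℕ))
    have h1 := Primrec.fst.comp hi
    have h2 := Primrec.fst.comp (Primrec.snd.comp hi)
    have h3 := Primrec.snd.comp (Primrec.snd.comp hi)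
    have hs : ∀ {γ : Type _} [Primcodable γ] {f : γ → LFormula}, Primrec f →
        Primrec fun c => [f c] := fun hf => Primrec.list_cons.comp hf (Primrec.const [])
    refine Primrec.list_append.comp
      (Primrec.cond (hq.comp (Primrec.pair ha h1) h3) (hs h1) (Primrec.const []))
      (Primrec.list_append.comp (Primrec.ite (PrimrecPred.and
        (primrecRel_mem_list.comp (LFormula.primrec_imp.comp h1 h2) hl)
        (primrecRel_mem_list.comp h1 hl)) (hs h2) (Primrec.const [])) hl)
  exact SemiDec.ex (of_primrecPred (primrecRel_mem_list.comp (Primrec.snd.comp Primrec.fst)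
    (Primrec.list_foldl Primrec.snd (Primrec.const []) hstep)))

end SemiDec

section

open Primrec

variable {α : Type*} [Primcodable α]

theorem SemiDec.logAx : SemiDec LogAx := by
  have hbv : PrimrecRel fun (c : ℕ) (B : LFormula) => c ∉ B.bv :=
    PrimrecPred.not (Primrec.primrecPred LFormula.primrec_mem_bv)
  have h1 : SemiDec fun χ : LFormula => ∃ x : LFormula × LFormula, χ = .imp x.1 (.imp x.2 x.1) :=
    range (LFormula.primrec_imp.comp fst (LFormula.primrec_imp.comp snd fst))
  have h2 : SemiDec fun χ : LFormula => ∃ x : LFormula × LFormula × LFormula,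
      χ = .imp (.imp x.1 (.imp x.2.1 x.2.2)) (.imp (.imp x.1 x.2.1) (.imp x.1 x.2.2)) := by
    have i := fst.comp (snd (α := LFormula) (β := LFormula × LFormula))
    have j := snd.comp (snd (α := LFormula) (β := LFormula × LFormula))
    exact range (LFormula.primrec_imp.comp
      (LFormula.primrec_imp.comp fst (LFormula.primrec_imp.comp i j))
      (LFormula.primrec_imp.comp (LFormula.primrec_imp.comp fst i)
        (LFormula.primrec_imp.comp fst j)))
  have h3 : SemiDec fun χ : LFormula => ∃ a, χ = .imp (notF (notF a)) a :=
    range (LFormula.primrec_imp.comp (primrec_notF.comp primrec_notF) Primrec.id)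
  have h4 : SemiDec fun χ : LFormula => ∃ x : ℕ × ℕ × LFormula, x.2.1 ∉ x.2.2.bv ∧
      χ = .imp (.all x.1 x.2.2) (subst1 x.1 (.var x.2.1) x.2.2) := by
    have i := fst.comp (snd (α := ℕ) (β := ℕ × LFormula))
    have j := snd.comp (snd (α := ℕ) (β := ℕ × LFormula))
    exact image (of_primrecPred (hbv.comp i j)) (LFormula.primrec_imp.comp
      (LFormula.primrec_all.comp fst j)
      (primrec_subst1.comp (pair fst (LTerm.primrec_var.comp i)) j))
  have h5 : SemiDec fun χ : LFormula => ∃ x : ℕ × LFormula,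
      χ = .imp (subst1 x.1 (.var (henkinVar x.1 x.2)) x.2) (.all x.1 x.2) :=
    range (LFormula.primrec_imp.comp (primrec_subst1.comp
      (pair fst (LTerm.primrec_var.comp (primrec_henkinVar.comp fst snd))) snd)
      (LFormula.primrec_all.comp fst snd))
  have h6 : SemiDec fun χ : LFormula => ∃ x : ℕ × ℕ × ℕ × LFormula,
      (x.2.1 ∉ x.2.2.2.bv ∧ x.2.2.1 ∉ x.2.2.2.bv) ∧
      χ = .imp (.eq (.var x.2.1) (.var x.2.2.1))
        (.imp (subst1 x.1 (.var x.2.1) x.2.2.2) (subst1 x.1 (.var x.2.2.1) x.2.2.2)) := by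
    have i := fst.comp (snd (α := ℕ) (β := ℕ × ℕ × LFormula))
    have s := snd.comp (snd (α := ℕ) (β := ℕ × ℕ × LFormula))
    have j := fst.comp s
    have k := snd.comp s
    have vi := LTerm.primrec_var.comp i
    have vj := LTerm.primrec_var.comp j
    exact image (of_primrecPred ((hbv.comp i k).and (hbv.comp j k))) (LFormula.primrec_imp.comp
      (LFormula.primrec_eq.comp vi vj) (LFormula.primrec_imp.comp
        (primrec_subst1.comp (pair fst vi) k) (primrec_subst1.comp (pair fst vj) k)))
  have h7 : SemiDec fun χ : LFormula => ∃ t : LTerm,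
      χ = notF (.all 0 (notF (.eq (.var 0) (t.rename oddVar)))) :=
    range (primrec_notF.comp (LFormula.primrec_all.comp (const 0) (primrec_notF.comp
      (LFormula.primrec_eq.comp (const (LTerm.var 0)) LTerm.primrec_rename_oddVar))))
  have h8 : SemiDec fun χ : LFormula => ∃ t, χ = .eq t t :=
    range (LFormula.primrec_eq.comp Primrec.id Primrec.id)
  have h9 : SemiDec fun χ : LFormula => ∃ x : LTerm × LTerm × LTerm,
      χ = .imp (.eq x.1 x.2.1) (.imp (.eq x.1 x.2.2) (.eq x.2.1 x.2.2)) := by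
    have i := fst.comp (snd (α := LTerm) (β := LTerm × LTerm))
    have j := snd.comp (snd (α := LTerm) (β := LTerm × LTerm))
    exact range (LFormula.primrec_imp.comp (LFormula.primrec_eq.comp fst i)
      (LFormula.primrec_imp.comp (LFormula.primrec_eq.comp fst j) (LFormula.primrec_eq.comp i j)))
  have h10 : SemiDec fun χ : LFormula => ∃ x : LTerm × LTerm,
      χ = .imp (.eq x.1 x.2) (.eq (.succ x.1) (.succ x.2)) :=
    range (LFormula.primrec_imp.comp (LFormula.primrec_eq.comp fst snd)
      (LFormula.primrec_eq.comp (LTerm.primrec_succ.comp fst) (LTerm.primrec_succ.comp snd)))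
  have hbin : ∀ {f : LTerm → LTerm → LTerm}, Primrec₂ f →
      SemiDec fun χ : LFormula => ∃ x : LTerm × LTerm × LTerm × LTerm,
        χ = .imp (.eq x.1 x.2.1) (.imp (.eq x.2.2.1 x.2.2.2)
          (.eq (f x.1 x.2.2.1) (f x.2.1 x.2.2.2))) := fun hf => by
    have i := fst.comp (snd (α := LTerm) (β := LTerm × LTerm × LTerm))
    have s := snd.comp (snd (α := LTerm) (β := LTerm × LTerm × LTerm))
    have j := fst.comp s
    have k := snd.comp s
    exact range (LFormula.primrec_imp.comp (LFormula.primrec_eq.comp fst i)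
      (LFormula.primrec_imp.comp (LFormula.primrec_eq.comp j k)
        (LFormula.primrec_eq.comp (hf.comp fst j) (hf.comp i k))))
  refine (h1.or <| h2.or <| h3.or <| h4.or <| h5.or <| h6.or <| h7.or <| h8.or <| h9.or <|
    h10.or <| (hbin LTerm.primrec_add).or (hbin LTerm.primrec_mul)).of_eq fun χ => ?_
  constructor
  · rintro (⟨x, rfl⟩ | ⟨x, rfl⟩ | ⟨x, rfl⟩ | ⟨x, h, rfl⟩ | ⟨x, rfl⟩ | ⟨x, h, rfl⟩ | ⟨x, rfl⟩ |
      ⟨x, rfl⟩ | ⟨x, rfl⟩ | ⟨x, rfl⟩ | ⟨x, rfl⟩ | ⟨x, rfl⟩)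
    exacts [.weak _ _, .dist _ _ _, .dne _, .inst _ _ _ h, .henkin _ _, .leibniz _ _ _ _ h.1 h.2,
      .exists_eq _, .refl _, .euclid _ _ _, .succ _ _, .add _ _ _ _, .mul _ _ _ _]
  · intro h
    cases h with
    | weak a b => exact .inl ⟨(a, b), rfl⟩
    | dist a b c => exact .inr (.inl ⟨(a, b, c), rfl⟩)
    | dne a => exact .inr (.inr (.inl ⟨a, rfl⟩))
    | inst z c B h => exact .inr (.inr (.inr (.inl ⟨(z, c, B), h, rfl⟩)))
    | henkin z B => exact .inr (.inr (.inr (.inr (.inl ⟨(z, B), rfl⟩))))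
    | leibniz z c d B hc hd =>
      exact .inr (.inr (.inr (.inr (.inr (.inl ⟨(z, c, d, B), ⟨hc, hd⟩, rfl⟩)))))
    | exists_eq t => exact .inr (.inr (.inr (.inr (.inr (.inr (.inl ⟨t, rfl⟩))))))
    | refl t => exact .inr (.inr (.inr (.inr (.inr (.inr (.inr (.inl ⟨t, rfl⟩)))))))
    | euclid t u w =>
      exact .inr (.inr (.inr (.inr (.inr (.inr (.inr (.inr (.inl ⟨(t, u, w), rfl⟩))))))))
    | succ t t' =>
      exact .inr (.inr (.inr (.inr (.inr (.inr (.inr (.inr (.inr (.inl ⟨(t, t'), rfl⟩)))))))))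
    | add t t' u u' =>
      iterate 10 apply Or.inr
      exact .inl ⟨(t, t', u, u'), rfl⟩
    | mul t t' u u' =>
      iterate 11 apply Or.inr
      exact ⟨(t, t', u, u'), rfl⟩

theorem SemiDec.consequence {T : α → Set LFormula}
    (hT : SemiDec fun x : α × LFormula => x.2 ∈ T x.1) :
    SemiDec fun x : α × LFormula => Consequence (T x.1) x.2 := by
  have h : SemiDec fun x : α × LFormula => x.2 ∈ HypAx (T x.1) := by
    refine (logAx.comp snd).or (ex (p := fun y : (α × LFormula) × LFormula =>
      y.2 ∈ T y.1.1 ∧ y.1.2 = closedForm y.2) ?_)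
    exact (hT.comp (pair (fst.comp fst) snd)).and
      (of_eq_primrec (snd.comp fst) (primrec_closedForm.comp snd))
  exact ((prov (T := fun y => HypAx (T y)) h).comp
    (pair fst (primrec_closedForm.comp snd))).of_eq fun _ => consequence_iff_prov.symm

theorem SemiDec.valid : SemiDec Valid := by
  have h : SemiDec fun x : Unit × LFormula => x.2 ∈ (∅ : Set LFormula) :=
    (of_eq_primrec (const 0) (const 1)).of_eq fun _ => by simp
  exact (consequence (T := fun _ => ∅) h).comp (pair (const ()) Primrec.id)

theorem SemiDec.paAx : SemiDec PAax := by
  have hl : SemiDec fun χ : LFormula => χ ∈ [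
      .all 0 (notF (.eq (.succ (.var 0)) .zero)),
      .all 0 (.all 1 (.imp (.eq (.succ (.var 0)) (.succ (.var 1))) (.eq (.var 0) (.var 1)))),
      .all 0 (.eq (.add (.var 0) .zero) (.var 0)),
      .all 0 (.all 1 (.eq (.add (.var 0) (.succ (.var 1))) (.succ (.add (.var 0) (.var 1))))),
      .all 0 (.eq (.mul (.var 0) .zero) .zero),
      .all 0 (.all 1 (.eq (.mul (.var 0) (.succ (.var 1))) (.add (.mul (.var 0) (.var 1))
        (.var 0))))] :=
    of_primrecPred (primrecRel_mem_list.comp Primrec.id (const _))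
  have hi : SemiDec fun χ : LFormula => ∃ x : LFormula × ℕ, χ = uclose (.imp (subst1 x.2 .zero x.1)
      (.imp (.all x.2 (.imp x.1 (subst1 x.2 (.succ (.var x.2)) x.1))) (.all x.2 x.1))) :=
    range (primrec_uclose.comp (LFormula.primrec_imp.comp
      (primrec_subst1.comp (pair snd (const _)) fst)
      (LFormula.primrec_imp.comp (LFormula.primrec_all.comp snd (LFormula.primrec_imp.comp fst
        (primrec_subst1.comp (pair snd (LTerm.primrec_succ.comp (LTerm.primrec_var.comp snd)))
          fst))) (LFormula.primrec_all.comp snd fst))))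
  refine (hl.or hi).of_eq fun χ => ?_
  simp only [List.mem_cons, List.not_mem_nil, or_false]
  constructor
  · rintro ((rfl | rfl | rfl | rfl | rfl | rfl) | ⟨x, rfl⟩)
    exacts [.succ_ne_zero, .succ_inj, .add_zero, .add_succ, .mul_zero, .mul_succ, .ind _ _]
  · intro h
    cases h with
    | ind φ x => exact .inr ⟨(φ, x), rfl⟩
    | _ => simp

/-- The axioms of `Σ(n)` other than those obtained from the closure under `K`. -/
inductive SigmaBase (pw : LFormula) (n : ℕ) : LFormula → Prop
  | logic {χ : LFormula} (h : χ ∈ E1set ∨ χ ∈ E2set ∨ χ ∈ E4set) : SigmaBase pw n χ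
  | pa {χ : LFormula} (h : PAax χ) : SigmaBase pw n χ
  | code (φ : LFormula) (h : φ.fv ⊆ {vx}) : SigmaBase pw n (line3 pw n φ)
  | av (φ : LFormula) (s : ℕ → ℕ) (h : Valid φ) : SigmaBase pw n (instNum s φ)

theorem sigmaAx_iff {pw : LFormula} {n : ℕ} {χ : LFormula} :
    SigmaAx pw n χ ↔ ∃ (j : ℕ) (ψ : LFormula), SigmaBase pw n ψ ∧ χ = LFormula.K^[j] ψ := by
  constructor
  · intro h
    induction h with
    | e1 h => exact ⟨0, _, .logic (.inl h), rfl⟩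
    | e2 h => exact ⟨0, _, .logic (.inr (.inl h)), rfl⟩
    | e4 h => exact ⟨0, _, .logic (.inr (.inr h)), rfl⟩
    | pa h => exact ⟨0, _, .pa h, rfl⟩
    | code φ h => exact ⟨0, _, .code φ h, rfl⟩
    | av φ s h => exact ⟨0, _, .av φ s h, rfl⟩
    | k _ ih =>
      obtain ⟨j, ψ, hψ, rfl⟩ := ih
      exact ⟨j + 1, ψ, hψ, (Function.iterate_succ_apply' _ _ _).symm⟩
  · rintro ⟨j, ψ, hψ, rfl⟩
    induction j with
    | zero =>
      cases hψ with
      | logic h => exact h.elim .e1 (Or.elim · .e2 .e4)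
      | pa h => exact .pa h
      | code φ h => exact .code φ h
      | av φ s h => exact .av φ s h
    | succ j ih => exact Function.iterate_succ_apply' LFormula.K j ψ ▸ .k ih

theorem SemiDec.sigmaBase (pw : LFormula) :
    SemiDec fun x : ℕ × LFormula => SigmaBase pw x.1 x.2 := by
  have e1 : SemiDec (· ∈ E1set) :=
    image valid (primrec_uclose.comp LFormula.primrec_K)
  have e2 : SemiDec fun χ : LFormula => ∃ x : LFormula × LFormula,
      χ = uclose (.imp (.K (.imp x.1 x.2)) (.imp (.K x.1) (.K x.2))) :=
    range (primrec_uclose.comp (LFormula.primrec_imp.comp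
      (LFormula.primrec_K.comp LFormula.primrec_imp)
      (LFormula.primrec_imp.comp (LFormula.primrec_K.comp fst) (LFormula.primrec_K.comp snd))))
  have e4 : SemiDec (· ∈ E4set) :=
    range (primrec_uclose.comp (LFormula.primrec_imp.comp LFormula.primrec_K
      (LFormula.primrec_K.comp LFormula.primrec_K)))
  have code : SemiDec fun x : ℕ × LFormula =>
      ∃ φ : LFormula, φ.fv ⊆ {vx} ∧ x.2 = line3 pw x.1 φ :=
    ex (p := fun y : (ℕ × LFormula) × LFormula => y.2.fv ⊆ {vx} ∧ y.1.2 = line3 pw y.1.1 y.2)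
      ((of_primrecPred ((LFormula.primrecPred_fv_subset vx).comp snd)).and
        (of_eq_primrec (snd.comp fst) ((primrec_line3 pw).comp (fst.comp fst) snd)))
  have av : SemiDec fun χ : LFormula => ∃ x : List ℕ × LFormula, Valid x.2 ∧ χ = instList x.1 x.2 :=
    image (valid.comp snd) primrec_instList
  refine ((e1.comp snd).or <| (e2.comp snd).or <| (e4.comp snd).or <| (paAx.comp snd).or <|
    code.or (av.comp snd)).of_eq fun x => ?_
  obtain ⟨n, χ⟩ := x
  dsimp only
  constructor
  · rintro (h | ⟨x, h⟩ | h | h | ⟨φ, h, h'⟩ | ⟨x, h, h'⟩)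
    · exact .logic (.inl h)
    · exact .logic (.inr (.inl ⟨_, _, h⟩))
    · exact .logic (.inr (.inr h))
    · exact .pa h
    · exact h' ▸ .code φ h
    · exact (h'.trans (instList_eq _ _)) ▸ .av _ _ h
  · intro h
    cases h with
    | logic h =>
      rcases h with h | ⟨φ, ψ, h⟩ | h
      exacts [.inl h, .inr (.inl ⟨(φ, ψ), h⟩), .inr (.inr (.inl h))]
    | pa h => exact .inr (.inr (.inr (.inl h)))
    | code φ h => exact .inr (.inr (.inr (.inr (.inl ⟨φ, h, rfl⟩))))
    | av φ s h =>
      obtain ⟨l, hl⟩ := exists_instList s φ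
      exact .inr (.inr (.inr (.inr (.inr ⟨(l, φ), h, hl⟩))))

theorem SemiDec.sigmaN (pw : LFormula) : SemiDec fun x : ℕ × LFormula => x.2 ∈ SigmaN pw x.1 := by
  have h : SemiDec fun x : ℕ × LFormula => ∃ y : ℕ × LFormula,
      SigmaBase pw x.1 y.2 ∧ x.2 = LFormula.K^[y.1] y.2 :=
    ex (p := fun z : (ℕ × LFormula) × ℕ × LFormula =>
        SigmaBase pw z.1.1 z.2.2 ∧ z.1.2 = LFormula.K^[z.2.1] z.2.2)
      (((sigmaBase pw).comp (pair (fst.comp fst) (snd.comp snd))).and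
        (of_eq_primrec (snd.comp fst) (nat_iterate (fst.comp snd) (snd.comp snd)
          (LFormula.primrec_K.comp snd).to₂)))
  exact h.of_eq fun x => by simpa [SigmaN] using sigmaAx_iff.symm

theorem SemiDec.goalSet (pw : LFormula) : SemiDec fun x : ℕ × ℕ => x.2 ∈ goalSet pw x.1 := by
  have h : SemiDec fun x : ℕ × ℕ => ∃ y : ℕ × LFormula, x.2 = Nat.pair y.1 y.2.gnum ∧
      y.2.fv ⊆ {vx} ∧ Consequence (SigmaN pw x.1) (subst1 vx (numeral y.1) y.2) := by
    have m := fst.comp (snd (α := ℕ × ℕ) (β := ℕ × LFormula))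
    have φ := snd.comp (snd (α := ℕ × ℕ) (β := ℕ × LFormula))
    exact ex (p := fun z : (ℕ × ℕ) × ℕ × LFormula => z.1.2 = Nat.pair z.2.1 z.2.2.gnum ∧
        z.2.2.fv ⊆ {vx} ∧ Consequence (SigmaN pw z.1.1) (subst1 vx (numeral z.2.1) z.2.2))
      ((of_eq_primrec (snd.comp fst) (Primrec₂.natPair.comp m (LFormula.primrec_gnum.comp φ))).and
        ((of_primrecPred ((LFormula.primrecPred_fv_subset vx).comp φ)).and
          ((consequence (sigmaN pw)).comp (pair (fst.comp fst)
            (primrec_subst1.comp (pair (const vx) (primrec_numeral.comp m)) φ)))))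
  exact h.of_eq fun x => by simp [_root_.goalSet]

end

/-- The recursion theorem for semidecidable families of sets of natural numbers. -/
theorem SemiDec.exists_W_eq {S : ℕ → Set ℕ} (hS : SemiDec fun x : ℕ × ℕ => x.2 ∈ S x.1) :
    ∃ n, W n = S n := by
  obtain ⟨q, hq, h⟩ := hS
  let f : Nat.Partrec.Code → ℕ →. ℕ := fun c m =>
    Nat.rfind fun k => Part.some (q (Encodable.encode c, m) k)
  have hf : Partrec₂ f := by
    refine Partrec.rfind (p := fun (x : Nat.Partrec.Code × ℕ) k =>
      Part.some (q (Encodable.encode x.1, x.2) k)) ?_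
    have : Primrec₂ fun (x : Nat.Partrec.Code × ℕ) k => q (Encodable.encode x.1, x.2) k :=
      hq.comp (Primrec.pair (Primrec.encode.comp (Primrec.fst.comp Primrec.fst))
        (Primrec.snd.comp Primrec.fst)) Primrec.snd
    exact this.to_comp.partrec₂
  obtain ⟨c, hc⟩ := Nat.Partrec.Code.fixed_point₂ hf
  refine ⟨Encodable.encode c, Set.ext fun m => ?_⟩
  refine Iff.trans ?_ (h (_, m)).symm
  have hd : (f c m).Dom ↔ ∃ n, q (Encodable.encode c, m) n = true := by
    refine (Nat.rfind_dom (p := fun k => Part.some (q (Encodable.encode c, m) k))).trans ?_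
    simp
  simpa [W, hc] using hd

/-- There exists n ∈ ℕ such that W_n = { ⟨m, ⌜φ⌝⟩ : φ an 𝓛-formula
with free variables ⊆ {x} and Σ(n) ⊨ φ(x|m̄) } (Kleene's recursion theorem). -/
theorem SigmaN_fixed_point (pw : LFormula) (hfv : pw.fv ⊆ {vx, vy, ve}) (hkf : KFree pw)
    (hcorr : ∀ a b k : ℕ, StdModel.Models (pwNum pw a b k) ↔ Nat.pair a b ∈ W k) :
    ∃ n : ℕ, W n = goalSet pw n :=
  (SemiDec.goalSet pw).exists_W_eq
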